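/- arXiv:2506.01528 — 5 statements merged into one kernel-verified Lean document; each statement's English description precedes it below -/
import Mathlib

section
/- Let (K,|·|) be a non-Archimedean valued field, let n be a positive integer, and let ‖·‖ be a non-Archimedean norm on K^n that is equivalent to the maximum norm ‖·‖_∞. Then there exists ε ∈ (0,1] such that every matrix A ∈ GL(n,D_K,ε) is a surjective linear isometry of (K^n,‖·‖), i.e., GL(n,D_K,ε) is a subgroup of IL(K^n,‖·‖). In fact, if C₁‖x‖_∞ ≤ ‖x‖ ≤ C₂‖x‖_∞ for all x ∈ K^n, then ε = C₁/C₂ works. -/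
/-- `v` is a non-Archimedean valuation on the field `K`: it is nonnegative, vanishes
exactly at `0`, is multiplicative, and satisfies the strong triangle inequality. -/
def IsNAVal {K : Type*} [Field K] (v : K → ℝ) : Prop :=
  (∀ x, 0 ≤ v x) ∧ (∀ x, v x = 0 ↔ x = 0) ∧
    (∀ x y, v (x * y) = v x * v y) ∧ (∀ x y, v (x + y) ≤ max (v x) (v y))

/-- `N` is a non-Archimedean norm on the `K`-vector space `X` with respect to the
valuation `v` on `K`. -/
def IsNANorm {K : Type*} [Field K] (v : K → ℝ) {X : Type*} [AddCommGroup X] [Module K X]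
    (N : X → ℝ) : Prop :=
  (∀ x, 0 ≤ N x) ∧ (∀ x, N x = 0 ↔ x = 0) ∧
    (∀ (c : K) (x : X), N (c • x) = v c * N x) ∧ (∀ x y, N (x + y) ≤ max (N x) (N y))

/-- The maximum norm `‖x‖_∞ = max_i v (x i)` on `K^n`. -/
noncomputable def maxNorm {K : Type*} [Field K] (v : K → ℝ) {n : ℕ} (x : Fin n → K) : ℝ :=
  sSup (Set.range fun i => v (x i))

/-- `A ∈ GL(n, D_K)`: all entries of `A` lie in the ring of integers
`D_K = {x : v x ≤ 1}`, and `A` has a two-sided inverse with entries in `D_K`. -/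
def MemGLD {K : Type*} [Field K] (v : K → ℝ) {n : ℕ} (A : Matrix (Fin n) (Fin n) K) : Prop :=
  (∀ i j, v (A i j) ≤ 1) ∧
    ∃ B : Matrix (Fin n) (Fin n) K, (∀ i j, v (B i j) ≤ 1) ∧ A * B = 1 ∧ B * A = 1

/-- `A ∈ GL(n, D_K, ε)`, the ε-principal congruence subgroup of `GL(n, D_K)`:
`v (A i j - δ i j) ≤ ε` for all `i, j`. -/
def MemGLDe {K : Type*} [Field K] (v : K → ℝ) (ε : ℝ) {n : ℕ}
    (A : Matrix (Fin n) (Fin n) K) : Prop :=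
  MemGLD v A ∧ ∀ i j, v (A i j - (1 : Matrix (Fin n) (Fin n) K) i j) ≤ ε

theorem aux_sum {K : Type*} [Field K] (v : K → ℝ) (hv : IsNAVal v) {ι : Type*} (s : Finset ι)
    (f : ι → K) (e : ℝ) (he : 0 ≤ e) (h : ∀ i, v (f i) ≤ e) : v (∑ i ∈ s, f i) ≤ e := by
  classical
  induction s using Finset.induction_on with
  | empty => simpa [(hv.2.1 0).2 rfl] using he
  | insert a s ha ih =>
    rw [Finset.sum_insert ha]
    exact (hv.2.2.2 _ _).trans (max_le (h a) ih)

theorem aux_le {K : Type*} [Field K] (v : K → ℝ) {n : ℕ} (x : Fin n → K) (i : Fin n) :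
    v (x i) ≤ maxNorm v x :=
  le_csSup (Set.finite_range _).bddAbove ⟨i, rfl⟩

theorem aux_one {K : Type*} [Field K] (v : K → ℝ) (hv : IsNAVal v) : v 1 = 1 := by
  have h := hv.2.2.1 1 1
  have h0 : v 1 ≠ 0 := fun h => one_ne_zero ((hv.2.1 1).1 h)
  rw [mul_one] at h
  exact (mul_eq_left₀ h0).1 h.symm

theorem aux_neg {K : Type*} [Field K] (v : K → ℝ) (hv : IsNAVal v) (x : K) : v (-x) = v x := by
  have h := hv.2.2.1 (-1) (-1)
  rw [neg_mul_neg, mul_one, aux_one v hv] at h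
  have h1 : v (-1) = 1 := by nlinarith [hv.1 (-1)]
  rw [← neg_one_mul, hv.2.2.1, h1, one_mul]

theorem aux_contr {K : Type*} [Field K] (v : K → ℝ) (hv : IsNAVal v)
    (n : ℕ) (hn : 0 < n) (N : (Fin n → K) → ℝ) (hN : IsNANorm v N)
    (C₁ C₂ : ℝ) (hC₁ : 0 < C₁) (hC₂ : 0 < C₂)
    (hlow : ∀ x : Fin n → K, C₁ * maxNorm v x ≤ N x)
    (hupp : ∀ x : Fin n → K, N x ≤ C₂ * maxNorm v x)
    (A : Matrix (Fin n) (Fin n) K)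
    (hA : ∀ i j, v (A i j - (1 : Matrix (Fin n) (Fin n) K) i j) ≤ C₁ / C₂) (x : Fin n → K) :
    N (A.mulVec x) ≤ N x := by
  have hm : 0 ≤ maxNorm v x := (hv.1 _).trans (aux_le v x ⟨0, hn⟩)
  have hne : Nonempty (Fin n) := ⟨⟨0, hn⟩⟩
  have hq : 0 ≤ C₁ / C₂ := by positivity
  have h1 : maxNorm v ((A - 1).mulVec x) ≤ C₁ / C₂ * maxNorm v x := by
    apply csSup_le (Set.range_nonempty _)
    rintro _ ⟨i, rfl⟩
    change v (∑ j, (A - 1) i j * x j) ≤ _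
    apply aux_sum v hv _ _ _ (by positivity)
    intro j
    rw [hv.2.2.1]
    exact mul_le_mul (hA i j) (aux_le v x j) (hv.1 _) hq
  have h2 : N ((A - 1).mulVec x) ≤ N x := by
    refine (hupp _).trans (le_trans ?_ (hlow x))
    calc C₂ * _ ≤ C₂ * (C₁ / C₂ * maxNorm v x) := by gcongr
      _ = C₁ * maxNorm v x := by field_simp
  have h3 : A.mulVec x = (A - 1).mulVec x + x := by
    rw [Matrix.sub_mulVec, Matrix.one_mulVec, sub_add_cancel]
  rw [h3]
  exact (hN.2.2.2 _ _).trans (max_le h2 le_rfl)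

theorem statement0 {K : Type*} [Field K] (v : K → ℝ) (hv : IsNAVal v)
    (n : ℕ) (hn : 0 < n) (N : (Fin n → K) → ℝ) (hN : IsNANorm v N)
    (C₁ C₂ : ℝ) (hC₁ : 0 < C₁) (hC₂ : 0 < C₂)
    (hlow : ∀ x : Fin n → K, C₁ * maxNorm v x ≤ N x)
    (hupp : ∀ x : Fin n → K, N x ≤ C₂ * maxNorm v x) :
    (∃ ε : ℝ, 0 < ε ∧ ε ≤ 1 ∧
      ∀ A : Matrix (Fin n) (Fin n) K, MemGLDe v ε A →
        Function.Surjective A.mulVec ∧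
          ∀ x y : Fin n → K, N (A.mulVec x - A.mulVec y) = N (x - y)) ∧
    (∀ A : Matrix (Fin n) (Fin n) K, MemGLDe v (C₁ / C₂) A →
      Function.Surjective A.mulVec ∧
        ∀ x y : Fin n → K, N (A.mulVec x - A.mulVec y) = N (x - y)) := by
  have hq : 0 < C₁ / C₂ := by positivity
  have main : ∀ A : Matrix (Fin n) (Fin n) K, MemGLDe v (C₁ / C₂) A →
      Function.Surjective A.mulVec ∧
        ∀ x y : Fin n → K, N (A.mulVec x - A.mulVec y) = N (x - y) := by
    rintro A ⟨⟨_, B, hB, hAB, hBA⟩, hA⟩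
    have hB1 : ∀ i j, v (B i j - (1 : Matrix (Fin n) (Fin n) K) i j) ≤ C₁ / C₂ := by
      intro i j
      have e : B - 1 = B * (-(A - 1)) := by
        rw [mul_neg, mul_sub, hBA, mul_one, neg_sub]
      rw [← Matrix.sub_apply, e, Matrix.mul_apply]
      apply aux_sum v hv _ _ _ hq.le
      intro k
      rw [hv.2.2.1, Matrix.neg_apply, aux_neg v hv]
      exact (mul_le_of_le_one_left (hv.1 _) (hB i k)).trans (hA k j)
    refine ⟨fun y => ⟨B.mulVec y, ?_⟩, fun x y => ?_⟩
    · rw [Matrix.mulVec_mulVec, hAB, Matrix.one_mulVec]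
    · rw [← Matrix.mulVec_sub]
      apply le_antisymm
      · exact aux_contr v hv n hn N hN C₁ C₂ hC₁ hC₂ hlow hupp A hA _
      · have := aux_contr v hv n hn N hN C₁ C₂ hC₁ hC₂ hlow hupp B hB1 (A.mulVec (x - y))
        rwa [Matrix.mulVec_mulVec, hBA, Matrix.one_mulVec] at this
  refine ⟨⟨C₁ / C₂, hq, ?_, main⟩, main⟩
  rw [div_le_one hC₂]
  have h := (hlow (fun _ => 1)).trans (hupp (fun _ => 1))
  have h1 : 1 ≤ maxNorm v (fun _ : Fin n => (1 : K)) := by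
    have := aux_le v (fun _ : Fin n => (1 : K)) ⟨0, hn⟩
    rwa [aux_one v hv] at this
  exact le_of_mul_le_mul_right h (by linarith)
end

section
/- Let (K,|·|) be a non-Archimedean valued field, let n be a positive integer, and let ‖·‖ be a non-Archimedean norm on K^n that is equivalent to the maximum norm ‖·‖_∞. Then there exists ε ∈ (0,1] such that every affine map in GA(n,D_K,ε) is a surjective affine isometry of (K^n,‖·‖), i.e., GA(n,D_K,ε) is a subgroup of IA(K^n,‖·‖). -/
/-- `f ∈ GA(n, D_K, ε)`: `f` is the affine map `x ↦ A x + τ` with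
`A ∈ GL(n, D_K, ε)` and `τ ∈ D_K^n` with `v (τ i) ≤ ε` for all `i`. -/
def MemGAe {K : Type*} [Field K] (v : K → ℝ) (ε : ℝ) {n : ℕ}
    (f : (Fin n → K) → Fin n → K) : Prop :=
  ∃ (A : Matrix (Fin n) (Fin n) K) (τ : Fin n → K),
    MemGLDe v ε A ∧ (∀ i, v (τ i) ≤ 1) ∧ (∀ i, v (τ i) ≤ ε) ∧ ∀ x, f x = A.mulVec x + τ

/-- `f ∈ IA(K^n, N)`: `f` is a surjective affine isometry of `(K^n, N)`. -/
def MemIA {K : Type*} [Field K] {n : ℕ} (N : (Fin n → K) → ℝ)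
    (f : (Fin n → K) → Fin n → K) : Prop :=
  (∃ (A : Matrix (Fin n) (Fin n) K) (τ : Fin n → K), ∀ x, f x = A.mulVec x + τ) ∧
    Function.Surjective f ∧ ∀ x y, N (f x - f y) = N (x - y)

theorem v_sum_le {K : Type*} [Field K] {v : K → ℝ} (hv : IsNAVal v) {ι : Type*}
    (s : Finset ι) (f : ι → K) (M : ℝ) (hM : 0 ≤ M) (h : ∀ i, v (f i) ≤ M) :
    v (∑ i ∈ s, f i) ≤ M := by
  classical
  induction s using Finset.induction_on with
  | empty =>
    rw [Finset.sum_empty, (hv.2.1 0).2 rfl]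
    exact hM
  | insert a s ha ih =>
    rw [Finset.sum_insert ha]
    exact (hv.2.2.2 _ _).trans (max_le (h a) ih)

theorem v_neg_one {K : Type*} [Field K] {v : K → ℝ} (hv : IsNAVal v) : v (-1) = 1 := by
  obtain ⟨h0, hz, hm, _⟩ := hv
  have h1 : v 1 = 1 := by
    have h := hm 1 1
    have h' : v 1 ≠ 0 := fun e => one_ne_zero ((hz 1).1 e)
    rw [mul_one] at h
    exact (mul_left_cancel₀ h' (by rw [← h, mul_one]))
  have h := hm (-1) (-1)
  rw [neg_mul_neg, one_mul, h1] at h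
  nlinarith [h0 (-1)]

theorem key {K : Type*} [Field K] {v : K → ℝ} (hv : IsNAVal v)
    {X : Type*} [AddCommGroup X] [Module K X] {N : X → ℝ} (hN : IsNANorm v N)
    (x y : X) (h : N (y - x) < N x) : N y = N x := by
  obtain ⟨h0, hz, hs, ha⟩ := hN
  have hneg : N (x - y) = N (y - x) := by
    have := hs (-1) (y - x)
    rw [v_neg_one hv, one_mul, neg_one_smul, neg_sub] at this
    exact this
  have h1 := ha (y - x) x
  have h2 := ha (x - y) y
  rw [sub_add_cancel] at h1 h2
  rw [max_eq_right h.le] at h1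
  rw [hneg] at h2
  rcases le_max_iff.1 h2 with h2 | h2 <;> linarith

theorem statement1 {K : Type*} [Field K] (v : K → ℝ) (hv : IsNAVal v)
    (n : ℕ) (hn : 0 < n) (N : (Fin n → K) → ℝ) (hN : IsNANorm v N)
    (heq : ∃ C₁ C₂ : ℝ, 0 < C₁ ∧ 0 < C₂ ∧
      ∀ x : Fin n → K, C₁ * maxNorm v x ≤ N x ∧ N x ≤ C₂ * maxNorm v x) :
    ∃ ε : ℝ, 0 < ε ∧ ε ≤ 1 ∧
      ∀ f : (Fin n → K) → Fin n → K, MemGAe v ε f → MemIA N f := by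
  obtain ⟨C₁, C₂, hC₁, hC₂, hC⟩ := heq
  have hbd : ∀ (x : Fin n → K) i, v (x i) ≤ maxNorm v x := fun x i =>
    le_csSup (Set.finite_range _).bddAbove ⟨i, rfl⟩
  have : Nonempty (Fin n) := ⟨⟨0, hn⟩⟩
  have hmax0 : ∀ x : Fin n → K, 0 ≤ maxNorm v x := fun x =>
    (hv.1 _).trans (hbd x ⟨0, hn⟩)
  have hε : 0 < min 1 (C₁ / (2 * C₂)) := by positivity
  refine ⟨min 1 (C₁ / (2 * C₂)), hε, min_le_left _ _, ?_⟩
  have hε2 : C₂ * min 1 (C₁ / (2 * C₂)) ≤ C₁ / 2 := by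
    calc C₂ * min 1 (C₁ / (2 * C₂)) ≤ C₂ * (C₁ / (2 * C₂)) := by
          gcongr
          exact min_le_right _ _
      _ = C₁ / 2 := by field_simp
  generalize min 1 (C₁ / (2 * C₂)) = ε at *
  rintro f ⟨A, τ, ⟨⟨_, B, _, hAB, _⟩, hA⟩, _, _, hf⟩
  refine ⟨⟨A, τ, hf⟩, ?_, ?_⟩
  · intro y
    refine ⟨B.mulVec (y - τ), ?_⟩
    rw [hf, Matrix.mulVec_mulVec, hAB, Matrix.one_mulVec, sub_add_cancel]
  · intro x y
    have e : f x - f y = A.mulVec (x - y) := by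
      rw [hf, hf, Matrix.mulVec_sub, add_sub_add_right_eq_sub]
    rw [e]
    generalize x - y = z
    by_cases hz : z = 0
    · rw [hz, Matrix.mulVec_zero]
    apply key hv hN
    have hpos : 0 < N z :=
      lt_of_le_of_ne (hN.1 z) (fun h => hz ((hN.2.1 z).1 h.symm))
    have hm : maxNorm v (A.mulVec z - z) ≤ ε * maxNorm v z := by
      apply csSup_le (Set.range_nonempty _)
      rintro _ ⟨i, rfl⟩
      have e2 : A.mulVec z - z = (A - 1).mulVec z := by
        rw [Matrix.sub_mulVec, Matrix.one_mulVec]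
      rw [e2]
      change v (∑ j, (A - 1) i j * z j) ≤ _
      apply v_sum_le hv _ _ _ (mul_nonneg hε.le (hmax0 z))
      intro j
      rw [hv.2.2.1]
      exact mul_le_mul (hA i j) (hbd z j) (hv.1 _) hε.le
    have h1 := (hC (A.mulVec z - z)).2
    have h2 := (hC z).1
    have h3 : C₂ * maxNorm v (A.mulVec z - z) ≤ C₂ * (ε * maxNorm v z) := by gcongr
    have h4 := mul_le_mul_of_nonneg_right hε2 (hmax0 z)
    linarith
end

section
/- Let (K,|·|) be a complete non-Archimedean valued field (i.e., K is complete with respect to the metric d(x,y) = |x−y|), let n be a positive integer, and let ‖·‖ be any non-Archimedean norm on K^n. Then there exists ε ∈ (0,1] such that GL(n,D_K,ε) is a subgroup of IL(K^n,‖·‖) and GA(n,D_K,ε) is a subgroup of IA(K^n,‖·‖). -/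
/-- `(K, v)` is complete: every Cauchy sequence with respect to the metric
`d (x, y) = v (x - y)` converges. -/
def IsCompleteVF {K : Type*} [Field K] (v : K → ℝ) : Prop :=
  ∀ s : ℕ → K,
    (∀ δ : ℝ, 0 < δ → ∃ M : ℕ, ∀ p q : ℕ, M ≤ p → M ≤ q → v (s p - s q) < δ) →
    ∃ l : K, ∀ δ : ℝ, 0 < δ → ∃ M : ℕ, ∀ p : ℕ, M ≤ p → v (s p - l) < δ

/-- `f ∈ IL(K^n, N)`: `f` is a surjective linear isometry of `(K^n, N)`. -/
def MemIL {K : Type*} [Field K] {n : ℕ} (N : (Fin n → K) → ℝ)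
    (f : (Fin n → K) → Fin n → K) : Prop :=
  (∃ A : Matrix (Fin n) (Fin n) K, ∀ x, f x = A.mulVec x) ∧
    Function.Surjective f ∧ ∀ x y, N (f x - f y) = N (x - y)

section helpers
variable {K : Type*} [Field K] {v : K → ℝ}

lemma NA_v_one (hv : IsNAVal v) : v 1 = 1 := by
  obtain ⟨h0, h1, h2, h3⟩ := hv
  have h : v 1 ≠ 0 := fun h => one_ne_zero ((h1 1).1 h)
  have := h2 1 1
  rw [mul_one] at this
  exact mul_left_cancel₀ h (by rw [mul_one]; exact this.symm)

lemma NA_v_neg_one (hv : IsNAVal v) : v (-1) = 1 := by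
  have h := hv.2.2.1 (-1) (-1)
  rw [neg_mul_neg, one_mul, NA_v_one hv] at h
  nlinarith [hv.1 (-1)]

lemma NA_neg (hv : IsNAVal v) {X : Type*} [AddCommGroup X] [Module K X] {N : X → ℝ}
    (hN : IsNANorm v N) (x : X) : N (-x) = N x := by
  have := hN.2.2.1 (-1) x
  rwa [NA_v_neg_one hv, one_mul, neg_one_smul] at this

lemma NA_sub (hv : IsNAVal v) {X : Type*} [AddCommGroup X] [Module K X] {N : X → ℝ}
    (hN : IsNANorm v N) (x y : X) : N (x - y) ≤ max (N x) (N y) := by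
  rw [sub_eq_add_neg, ← NA_neg hv hN y]
  exact hN.2.2.2 _ _

lemma NA_self (hv : IsNAVal v) : IsNANorm v v :=
  ⟨hv.1, hv.2.1, fun c x => hv.2.2.1 c x, hv.2.2.2⟩

lemma NA_sum {X : Type*} [AddCommGroup X] [Module K X] {N : X → ℝ}
    (hN : IsNANorm v N) {ι : Type*} (s : Finset ι) (f : ι → X) (t : ℝ) (ht : 0 ≤ t)
    (h : ∀ i, N (f i) ≤ t) : N (∑ i ∈ s, f i) ≤ t := by
  classical
  induction s using Finset.induction_on with
  | empty => rw [Finset.sum_empty, (hN.2.1 0).2 rfl]; exact ht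
  | insert a s ha ih =>
    rw [Finset.sum_insert ha]
    exact (hN.2.2.2 _ _).trans (max_le (h a) ih)

lemma NA_upper {n : ℕ} {N : (Fin n → K) → ℝ} (hN : IsNANorm v N) :
    ∃ C : ℝ, 0 < C ∧ ∀ (x : Fin n → K) (t : ℝ), 0 ≤ t → (∀ i, v (x i) ≤ t) → N x ≤ C * t := by
  refine ⟨1 + ∑ j, N (Pi.single j 1), ?_, ?_⟩
  · have : 0 ≤ ∑ j, N (Pi.single j 1) := Finset.sum_nonneg fun j _ => hN.1 _
    linarith
  · intro x t ht hx
    have hs : ∀ j, N (Pi.single j 1) ≤ 1 + ∑ j, N (Pi.single j 1) := by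
      intro j
      have := Finset.single_le_sum (f := fun j : Fin n => N (Pi.single j 1))
        (fun j _ => hN.1 _) (Finset.mem_univ j)
      linarith
    have h0 : 0 ≤ 1 + ∑ j, N (Pi.single j 1) := by
      have : 0 ≤ ∑ j, N (Pi.single j 1) := Finset.sum_nonneg fun j _ => hN.1 _
      linarith
    have hx' : x = ∑ i, x i • (Pi.single i (1 : K) : Fin n → K) := by
      ext j
      simp [Finset.sum_apply, Pi.single_apply]
    rw [hx']
    refine NA_sum hN _ _ _ (mul_nonneg h0 ht) fun i => ?_
    rw [hN.2.2.1, mul_comm]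
    exact mul_le_mul (hs i) (hx i) (by
      have := hN.1 (x i • (Pi.single i (1 : K) : Fin n → K))
      by_contra hneg
      push Not at hneg
      have h1 := hN.2.2.1 (x i) (Pi.single i (1 : K) : Fin n → K)
      have h2 : N (Pi.single i (1 : K) : Fin n → K) ≠ 0 := by
        rw [Ne, hN.2.1]
        simp
      have h3 := lt_of_le_of_ne (hN.1 _) (Ne.symm h2)
      nlinarith) h0

lemma NA_lower (hv : IsNAVal v) (hc : IsCompleteVF v) {n : ℕ} {N : (Fin n → K) → ℝ}
    (hN : IsNANorm v N) (S : Finset (Fin n)) :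
    ∃ D : ℝ, 0 < D ∧ ∀ x : Fin n → K, (∀ j, j ∉ S → x j = 0) → ∀ i, v (x i) ≤ D * N x := by
  classical
  obtain ⟨C, hC, hCx⟩ := NA_upper hN
  have v0 : v 0 = 0 := (hv.2.1 0).2 rfl
  induction S using Finset.induction_on with
  | empty =>
    refine ⟨1, one_pos, fun x hx i => ?_⟩
    rw [hx i (by simp), v0, one_mul]
    exact hN.1 x
  | insert a S ha ih =>
    obtain ⟨D, hD, hDx⟩ := ih
    have key : ∃ E : ℝ, 0 < E ∧ ∀ x : Fin n → K, (∀ j, j ∉ insert a S → x j = 0) →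
        v (x a) ≤ E * N x := by
      by_contra hcon
      push Not at hcon
      have hseq : ∀ k : ℕ, ∃ y : Fin n → K, (∀ j, j ∉ insert a S → y j = 0) ∧ y a = 1 ∧
          N y < 1 / ((k : ℝ) + 1) := by
        intro k
        have hk : (0 : ℝ) < (k : ℝ) + 1 := by positivity
        obtain ⟨x, hx, hlt⟩ := hcon ((k : ℝ) + 1) hk
        have hpos : 0 < v (x a) := lt_of_le_of_lt (mul_nonneg hk.le (hN.1 x)) hlt
        have hne : x a ≠ 0 := fun h => by rw [h, v0] at hpos; exact lt_irrefl _ hpos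
        refine ⟨(x a)⁻¹ • x, fun j hj => by simp [hx j hj], by simp [hne], ?_⟩
        rw [hN.2.2.1]
        have h1 : v (x a)⁻¹ * v (x a) = 1 := by
          rw [← hv.2.2.1, inv_mul_cancel₀ hne, NA_v_one hv]
        have h2 : 0 < v (x a)⁻¹ := by
          by_contra h
          push Not at h
          nlinarith
        rw [lt_div_iff₀ hk]
        nlinarith
      choose y hy0 hya hyN using hseq
      have hsmall : ∀ δ : ℝ, 0 < δ → ∃ M : ℕ, ∀ p, M ≤ p → N (y p) < δ := by
        intro δ hδ
        obtain ⟨M, hM⟩ := exists_nat_one_div_lt hδ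
        refine ⟨M, fun p hp => (hyN p).trans (lt_of_le_of_lt ?_ hM)⟩
        exact one_div_le_one_div_of_le (by positivity) (by
          have : (M : ℝ) ≤ p := by exact_mod_cast hp
          linarith)
      have hlim : ∀ i, ∃ l : K, ∀ δ : ℝ, 0 < δ → ∃ M : ℕ, ∀ p : ℕ, M ≤ p →
          v (y p i - l) < δ := by
        intro i
        apply hc (fun p => y p i)
        intro δ hδ
        obtain ⟨M, hM⟩ := hsmall (δ / D) (div_pos hδ hD)
        refine ⟨M, fun p q hp hq => ?_⟩
        have h1 := hDx (y p - y q) (fun j hj => by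
          by_cases hja : j = a
          · subst hja; simp [hya]
          · simp [hy0 _ j (by simp [hja, hj])]) i
        have h2 := lt_of_le_of_lt (NA_sub hv hN (y p) (y q)) (max_lt (hM p hp) (hM q hq))
        rw [lt_div_iff₀ hD] at h2
        refine lt_of_le_of_lt h1 ?_
        linarith
      choose l hl using hlim
      have hl0 : N l = 0 := by
        by_contra hne
        have hpos := lt_of_le_of_ne (hN.1 l) (Ne.symm hne)
        obtain ⟨M, hM⟩ := hsmall (N l) hpos
        have hδ : 0 < N l / (2 * C) := by positivity
        choose M' hM' using fun i => hl i _ hδ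
        let p := M + ∑ i, M' i
        have hp1 : N (y p) < N l := hM p (Nat.le_add_right _ _)
        have hp2 : N (y p - l) ≤ C * (N l / (2 * C)) := by
          apply hCx _ _ hδ.le
          intro i
          refine (hM' i p ?_).le
          exact (Finset.single_le_sum (f := M') (fun _ _ => Nat.zero_le _)
            (Finset.mem_univ i)).trans (Nat.le_add_left _ _)
        have hp3 : C * (N l / (2 * C)) = N l / 2 := by field_simp
        have h4 := NA_sub hv hN (y p) (y p - l)
        rw [sub_sub_cancel] at h4
        have h5 : max (N (y p)) (N (y p - l)) < N l := max_lt hp1 (by linarith)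
        linarith
      have hlz : l = 0 := (hN.2.1 l).1 hl0
      obtain ⟨M, hM⟩ := hl a 1 one_pos
      have := hM M le_rfl
      rw [hya, hlz, Pi.zero_apply, sub_zero, NA_v_one hv] at this
      exact lt_irrefl _ this
    obtain ⟨E, hE, hEx⟩ := key
    have he : 0 ≤ N (Pi.single a 1) := hN.1 _
    refine ⟨E + D * (1 + E * N (Pi.single a 1)), by positivity, fun x hx i => ?_⟩
    have hxa := hEx x hx
    have hNx := hN.1 x
    by_cases hia : i = a
    · subst hia
      have : 0 ≤ D * (1 + E * N (Pi.single i 1)) * N x := by positivity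
      linarith
    · have h1 := hDx (x - x a • (Pi.single a (1 : K) : Fin n → K)) (fun j hj => by
        by_cases hja : j = a
        · subst hja; simp
        · simp [hja, hx j (by simp [hja, hj])]) i
      have h2 := NA_sub hv hN x (x a • (Pi.single a (1 : K) : Fin n → K))
      rw [hN.2.2.1] at h2
      have h3 : max (N x) (v (x a) * N (Pi.single a 1)) ≤ (1 + E * N (Pi.single a 1)) * N x := by
        have := mul_le_mul_of_nonneg_right hxa he
        have h4 : 0 ≤ E * N (Pi.single a 1) * N x := by positivity
        have h5 := mul_nonneg (hv.1 (x a)) he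
        apply max_le <;> nlinarith
      have h4 := mul_le_mul_of_nonneg_left (h2.trans h3) hD.le
      have h5 : (x - x a • (Pi.single a (1 : K) : Fin n → K)) i = x i := by simp [hia]
      rw [h5] at h1
      have h6 : 0 ≤ E * N x := by positivity
      linarith

end helpers

theorem statement2 {K : Type*} [Field K] (v : K → ℝ) (hv : IsNAVal v)
    (hcomplete : IsCompleteVF v)
    (n : ℕ) (hn : 0 < n) (N : (Fin n → K) → ℝ) (hN : IsNANorm v N) :
    ∃ ε : ℝ, 0 < ε ∧ ε ≤ 1 ∧
      (∀ A : Matrix (Fin n) (Fin n) K, MemGLDe v ε A → MemIL N A.mulVec) ∧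
      (∀ f : (Fin n → K) → Fin n → K, MemGAe v ε f → MemIA N f) := by
  obtain ⟨C, hC, hCx⟩ := NA_upper hN
  obtain ⟨D, hD, hDx⟩ := NA_lower hv hcomplete hN Finset.univ
  have hDx' : ∀ (x : Fin n → K) i, v (x i) ≤ D * N x := fun x => hDx x (by simp)
  have hε : 0 < min 1 (1 / (2 * C * D)) := by positivity
  have main : ∀ A : Matrix (Fin n) (Fin n) K, MemGLDe v (min 1 (1 / (2 * C * D))) A →
      Function.Surjective A.mulVec ∧ ∀ x, N (A.mulVec x) = N x := by
    rintro A ⟨⟨_, B, _, hAB, _⟩, hA⟩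
    refine ⟨fun y => ⟨B.mulVec y, by rw [Matrix.mulVec_mulVec, hAB, Matrix.one_mulVec]⟩, ?_⟩
    intro x
    by_cases hx : x = 0
    · rw [hx, Matrix.mulVec_zero]
    have hpos : 0 < N x := lt_of_le_of_ne (hN.1 x) fun h => hx ((hN.2.1 x).1 h.symm)
    have hlt : N ((A - 1).mulVec x) < N x := by
      have h1 : N ((A - 1).mulVec x) ≤ C * (1 / (2 * C * D) * (D * N x)) := by
        apply hCx _ _ (by positivity)
        intro i
        rw [Matrix.mulVec, dotProduct]
        refine NA_sum (NA_self hv) _ _ _ (by positivity) fun j => ?_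
        rw [hv.2.2.1]
        exact mul_le_mul ((hA i j).trans (min_le_right _ _)) (hDx' x j) (hv.1 _) (by positivity)
      have h2 : C * (1 / (2 * C * D) * (D * N x)) = N x / 2 := by field_simp
      linarith
    have e : A.mulVec x = x + (A - 1).mulVec x := by
      rw [Matrix.sub_mulVec, Matrix.one_mulVec]; abel
    apply le_antisymm
    · rw [e]
      exact (hN.2.2.2 _ _).trans (max_le le_rfl hlt.le)
    · by_contra hcon
      push Not at hcon
      have h := NA_sub hv hN (A.mulVec x) ((A - 1).mulVec x)
      have e2 : A.mulVec x - (A - 1).mulVec x = x := by rw [e]; abel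
      rw [e2] at h
      exact absurd h (not_le.2 (max_lt hcon hlt))
  refine ⟨_, hε, min_le_left _ _, fun A hA => ?_, ?_⟩
  · obtain ⟨h1, h2⟩ := main A hA
    exact ⟨⟨A, fun _ => rfl⟩, h1, fun x y => by rw [← Matrix.mulVec_sub, h2]⟩
  · rintro f ⟨A, τ, hA, _, _, hf⟩
    obtain ⟨h1, h2⟩ := main A hA
    refine ⟨⟨A, τ, hf⟩, fun y => ?_, fun x y => ?_⟩
    · obtain ⟨x, hx⟩ := h1 (y - τ)
      exact ⟨x, by rw [hf, hx, sub_add_cancel]⟩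
    · rw [hf, hf, add_sub_add_right_eq_sub, ← Matrix.mulVec_sub, h2]
end

section
/- Let (K,|·|) be a non-Archimedean valued field whose residue field k satisfies ch K ≠ ch k (equivalently, ch K = 0 and ch k = p > 0). Then for every n ≥ 2 and every ε ∈ (0,1] there exists a free subgroup of rank two F₂ ≤ SA(n,ℤ,ε) whose action on K^n is locally commutative. -/
/-- `f ∈ SA(n, ℤ, ε)`: `f` is the affine map `x ↦ A x + τ` of `K^n` where `A` is
(the image in `K` of) an integer matrix of determinant one with
`v (A i j - δ i j) ≤ ε`, and `τ` is (the image of) an integer vector with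
`v (τ i) ≤ ε` for all `i`. -/
def MemSAZe {K : Type*} [Field K] (v : K → ℝ) (ε : ℝ) {n : ℕ}
    (f : (Fin n → K) → Fin n → K) : Prop :=
  ∃ (A : Matrix (Fin n) (Fin n) ℤ) (τ : Fin n → ℤ),
    A.det = 1 ∧
    (∀ i j, v ((A i j : K) - (1 : Matrix (Fin n) (Fin n) K) i j) ≤ ε) ∧
    (∀ i, v ((τ i : K)) ≤ ε) ∧
    ∀ x, f x = (A.map (Int.cast : ℤ → K)).mulVec x + fun i => ((τ i : K))

def li6 (s : Bool × Bool) : Bool × Bool := (s.1, !s.2)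

structure PP6 {X : Type*} (Φ : FreeGroup Bool →* Equiv.Perm X) (U : Bool × Bool → Set X)
    (sz : X → ℚ) : Prop where
  h1 : ∀ x s t r, s ≠ t → t ≠ r → s ≠ r → x ∈ U s → x ∈ U t → x ∈ U r → False
  h2 : ∀ x s, x ∉ U s → sz x < sz (Φ (FreeGroup.mk [s])⁻¹ x)
  h3 : ∀ x s t, t ≠ li6 s → x ∉ U s → Φ (FreeGroup.mk [s])⁻¹ x ∉ U t

theorem mk_cons6 (s : Bool × Bool) (l : List (Bool × Bool)) :
    FreeGroup.mk (s :: l) = FreeGroup.mk [s] * FreeGroup.mk l := by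
  rw [FreeGroup.mul_mk]; rfl

theorem mk_li6 (s : Bool × Bool) : FreeGroup.mk [li6 s] = (FreeGroup.mk [s])⁻¹ := by
  simp [li6, FreeGroup.invRev]

theorem pp_path6 {X : Type*} {Φ : FreeGroup Bool →* Equiv.Perm X} {U : Bool × Bool → Set X}
    {sz : X → ℚ} (H : PP6 Φ U sz) : ∀ (l : List (Bool × Bool)) (s : Bool × Bool) (x : X),
    FreeGroup.IsReduced (s :: l) → x ∉ U s →
      sz x < sz (Φ (FreeGroup.mk (s :: l))⁻¹ x) ∧
      ∃ r, ∀ t, t ≠ r → Φ (FreeGroup.mk (s :: l))⁻¹ x ∉ U t := by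
  intro l
  induction l with
  | nil => exact fun s x _ hx => ⟨H.h2 x s hx, li6 s, fun t ht => H.h3 x s t ht hx⟩
  | cons t l ih =>
    intro s x hr hx
    rw [FreeGroup.isReduced_cons_cons] at hr
    have ht : t ≠ li6 s := by
      rintro rfl
      have := hr.1 rfl
      simp [li6] at this
    obtain ⟨h, r, hr'⟩ := ih t _ hr.2 (H.h3 x s t ht hx)
    have e : Φ (FreeGroup.mk (s :: t :: l))⁻¹ x =
        Φ (FreeGroup.mk (t :: l))⁻¹ (Φ (FreeGroup.mk [s])⁻¹ x) := by
      rw [mk_cons6 s (t :: l), mul_inv_rev, map_mul]; rfl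
    rw [e]
    exact ⟨(H.h2 x s hx).trans h, r, hr'⟩

theorem fix_inv6 {X : Type*} {Φ : FreeGroup Bool →* Equiv.Perm X} {g : FreeGroup Bool} {x : X}
    (h : Φ g x = x) : Φ g⁻¹ x = x := by
  rw [map_inv, Equiv.Perm.inv_eq_iff_eq, h]

theorem pp_head6 {X : Type*} {Φ : FreeGroup Bool →* Equiv.Perm X} {U : Bool × Bool → Set X}
    {sz : X → ℚ} (H : PP6 Φ U sz) {g : FreeGroup Bool} {x : X} (h : Φ g x = x)
    {s : Bool × Bool} {l : List (Bool × Bool)} (e : g.toWord = s :: l) : x ∈ U s := by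
  by_contra hx
  have h1 := (pp_path6 H l s x (e ▸ FreeGroup.isReduced_toWord) hx).1
  rw [← e, FreeGroup.mk_toWord, fix_inv6 h] at h1
  exact lt_irrefl _ h1

theorem list_cmp6 {α : Type*} : ∀ l1 l2 : List α, l1 <+: l2 ∨ l2 <+: l1 ∨
    ∃ c s t u w, l1 = c ++ s :: u ∧ l2 = c ++ t :: w ∧ s ≠ t := by
  intro l1
  induction l1 with
  | nil => intro l2; left; exact List.nil_prefix
  | cons a l ih =>
    intro l2
    cases l2 with
    | nil => right; left; exact List.nil_prefix
    | cons b m =>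
      by_cases hab : a = b
      · subst hab
        rcases ih m with h | h | ⟨c, s, t, u, w, h1, h2, h3⟩
        · left; simpa using h
        · right; left; simpa using h
        · right; right; exact ⟨a :: c, s, t, u, w, by simp [h1], by simp [h2], h3⟩
      · right; right; exact ⟨[], a, b, l, m, rfl, rfl, hab⟩

/-- points with two bad letters: stabilizer elements with the same head are comparable -/
theorem pp_prefix6 {X : Type*} {Φ : FreeGroup Bool →* Equiv.Perm X} {U : Bool × Bool → Set X}
    {sz : X → ℚ} (H : PP6 Φ U sz) {y : X} (hy : ∀ r, ∃ t, t ≠ r ∧ y ∈ U t)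
    {g h : FreeGroup Bool} (hg : Φ g y = y) (hh : Φ h y = y) {a : Bool × Bool}
    {l m : List (Bool × Bool)} (eg : g.toWord = a :: l) (eh : h.toWord = a :: m) :
    g.toWord <+: h.toWord ∨ h.toWord <+: g.toWord := by
  rcases list_cmp6 g.toWord h.toWord with h' | h' | ⟨c, s, t, u, w, h1, h2, h3⟩
  · exact Or.inl h'
  · exact Or.inr h'
  exfalso
  have hc : c ≠ [] := by
    rintro rfl
    rw [eg] at h1; rw [eh] at h2
    simp at h1 h2
    exact h3 (h1.1.symm.trans h2.1)
  obtain ⟨c', r, rfl⟩ := List.eq_nil_or_concat' c |>.resolve_left hc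
  set z := Φ (FreeGroup.mk (c' ++ [r]))⁻¹ y with hz
  have key : ∀ (k : FreeGroup Bool) (s : Bool × Bool) (u : List (Bool × Bool)), Φ k y = y →
      k.toWord = (c' ++ [r]) ++ s :: u → z ∈ U s ∧ s ≠ li6 r := by
    intro k s u hk e
    have hred : FreeGroup.IsReduced ((c' ++ [r]) ++ s :: u) := e ▸ FreeGroup.isReduced_toWord
    constructor
    · by_contra hzs
      obtain ⟨-, q, hq⟩ := pp_path6 H u s z (hred.infix ⟨c' ++ [r], [], by simp⟩) hzs
      obtain ⟨t, ht, hyt⟩ := hy q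
      apply hq t ht
      have : Φ (FreeGroup.mk (s :: u))⁻¹ z = y := by
        rw [hz, ← Equiv.Perm.mul_apply, ← map_mul, ← mul_inv_rev, FreeGroup.mul_mk, ← e,
          FreeGroup.mk_toWord]
        exact fix_inv6 hk
      rwa [this]
    · rintro rfl
      have : FreeGroup.IsReduced (r :: [li6 r]) := hred.infix ⟨c', u, by simp⟩
      rw [FreeGroup.isReduced_cons_cons] at this
      have := this.1 rfl
      simp [li6] at this
  have hs := key g s u hg h1
  have ht := key h t w hh h2
  have hr : z ∈ U (li6 r) := by
    by_contra hzr
    have e1 : FreeGroup.invRev (c' ++ [r]) = li6 r :: FreeGroup.invRev c' := by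
      simp [FreeGroup.invRev, li6]
    have hred : FreeGroup.IsReduced (c' ++ [r]) := 
      (h1 ▸ (FreeGroup.isReduced_toWord (x := g)) : FreeGroup.IsReduced _).infix
        ⟨[], s :: u, by simp⟩
    have hred2 : FreeGroup.IsReduced (li6 r :: FreeGroup.invRev c') := by
      rw [← e1]
      rw [FreeGroup.isReduced_iff_reduce_eq] at hred ⊢
      rw [FreeGroup.reduce_invRev, hred]
    obtain ⟨-, q, hq⟩ := pp_path6 H _ _ z hred2 hzr
    obtain ⟨t, ht, hyt⟩ := hy q
    apply hq t ht
    have : Φ (FreeGroup.mk (li6 r :: FreeGroup.invRev c'))⁻¹ z = y := by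
      rw [← e1, ← FreeGroup.inv_mk, inv_inv, hz, ← Equiv.Perm.mul_apply, ← map_mul, mul_inv_cancel]
      simp
    rwa [this]
  exact H.h1 z s t (li6 r) h3 ht.2 hs.2 hs.1 ht.1 hr

theorem pp_main6 {X : Type*} {Φ : FreeGroup Bool →* Equiv.Perm X} {U : Bool × Bool → Set X}
    {sz : X → ℚ} (H : PP6 Φ U sz) (x : X) (g₁ g₂ : FreeGroup Bool) (hg₁ : Φ g₁ x = x)
    (hg₂ : Φ g₂ x = x) : g₁ * g₂ = g₂ * g₁ := by
  classical
  by_cases h1 : g₁ = 1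
  · simp [h1]
  let P : ℕ → Prop := fun n => ∃ c g : FreeGroup Bool, g ≠ 1 ∧ Φ g (Φ c x) = Φ c x ∧ g.norm = n
  have hP : ∃ n, P n := ⟨_, 1, g₁, h1, by simpa using hg₁, rfl⟩
  obtain ⟨c, g, hg1, hgy, hgn⟩ := Nat.find_spec hP
  have hmin : ∀ (d k : FreeGroup Bool), k ≠ 1 → Φ k (Φ d x) = Φ d x → g.norm ≤ k.norm := by
    intro d k hk hkd
    rw [hgn]
    exact Nat.find_min' hP ⟨d, k, hk, hkd, rfl⟩
  clear hgn
  set y := Φ c x with hy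
  obtain ⟨α, l, eg⟩ : ∃ α l, g.toWord = α :: l := by
    cases e : g.toWord with
    | nil => exact absurd (FreeGroup.toWord_eq_nil_iff.1 e) hg1
    | cons a l => exact ⟨a, l, rfl⟩
  obtain ⟨β, l', eg'⟩ : ∃ α l, g⁻¹.toWord = α :: l := by
    cases e : g⁻¹.toWord with
    | nil => exact absurd (inv_eq_one.1 (FreeGroup.toWord_eq_nil_iff.1 e)) hg1
    | cons a l => exact ⟨a, l, rfl⟩
  have hne : α ≠ β := by
    rintro rfl
    -- conjugate is shorter
    have e2 : g.toWord = FreeGroup.invRev l' ++ [li6 α] := by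
      have := congrArg FreeGroup.invRev eg'
      rw [FreeGroup.toWord_inv, FreeGroup.invRev_invRev] at this
      rw [this]; simp [FreeGroup.invRev, li6]
    obtain ⟨m, hm⟩ : ∃ m, g.toWord = α :: (m ++ [li6 α]) := by
      cases e : FreeGroup.invRev l' with
      | nil =>
        rw [e, eg] at e2
        simp [li6, Prod.ext_iff] at e2
      | cons b m =>
        rw [e, eg] at e2
        simp at e2
        exact ⟨m, by rw [eg, e2.2]⟩
    have eg3 : g = FreeGroup.mk [α] * FreeGroup.mk m * (FreeGroup.mk [α])⁻¹ := by
      rw [← FreeGroup.mk_toWord (x := g), hm, mk_cons6, ← FreeGroup.mul_mk, mk_li6, mul_assoc]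
    have h := hmin ((FreeGroup.mk [α])⁻¹ * c) (FreeGroup.mk m) (by
        intro hh; apply hg1; rw [eg3, hh, mul_one, mul_inv_cancel]) (by
        have : FreeGroup.mk m = (FreeGroup.mk [α])⁻¹ * g * FreeGroup.mk [α] := by
          rw [eg3]; group
        rw [← Equiv.Perm.mul_apply, ← map_mul, this]
        have e5 : (FreeGroup.mk [α])⁻¹ * g * FreeGroup.mk [α] * ((FreeGroup.mk [α])⁻¹ * c)
          = (FreeGroup.mk [α])⁻¹ * (g * c) := by group
        rw [e5, map_mul, map_mul, map_mul]
        simp only [Equiv.Perm.mul_apply]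
        rw [← hy, hgy])
    have h5 := FreeGroup.norm_mk_le (L₁ := m)
    have h6 : g.norm = m.length + 2 := by
      rw [FreeGroup.norm, hm]; simp
    omega
  have hα := pp_head6 H hgy eg
  have hβ := pp_head6 H (fix_inv6 hgy) eg'
  have hyb : ∀ r, ∃ t, t ≠ r ∧ y ∈ U t := by
    intro r
    by_cases h : α = r
    · exact ⟨β, fun h' => hne (h.trans h'.symm), hβ⟩
    · exact ⟨α, h, hα⟩
  have step : ∀ (k h : FreeGroup Bool) (a : Bool × Bool) (l m : List (Bool × Bool)),
      Φ k y = y → Φ h y = y → k.norm = g.norm → k.toWord = a :: l → h.toWord = a :: m →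
      (k⁻¹ * h).norm < h.norm := by
    intro k h a l m hk hh hn ek eh
    have hh1 : h ≠ 1 := by
      rintro rfl; simp at eh
    have hle := hmin c h hh1 hh
    have hpre : k.toWord <+: h.toWord := by
      rcases pp_prefix6 H hyb hk hh ek eh with h' | h'
      · exact h'
      · have := h'.eq_of_length_le (by rw [← hn] at hle; exact hle)
        rw [this]
    obtain ⟨w, hw⟩ := hpre
    have e : k⁻¹ * h = FreeGroup.mk w := by
      rw [← FreeGroup.mk_toWord (x := h), ← hw, ← FreeGroup.mul_mk, FreeGroup.mk_toWord]; group
    rw [e]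
    refine lt_of_le_of_lt FreeGroup.norm_mk_le ?_
    rw [FreeGroup.norm, ← hw, ek]; simp
  have main : ∀ (n : ℕ) (h : FreeGroup Bool), h.norm = n → Φ h y = y → h ∈ Subgroup.zpowers g := by
    intro n
    induction n using Nat.strong_induction_on with
    | _ n ih =>
      intro h hn hh
      cases e : h.toWord with
      | nil => rw [FreeGroup.toWord_eq_nil_iff.1 e]; exact one_mem _
      | cons a m =>
        have ha := pp_head6 H hh e
        by_cases h1 : a = α
        · subst h1
          have := step g h a l m hgy hh rfl eg e
          have := ih _ (hn ▸ this) (g⁻¹ * h) rfl (by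
            rw [map_mul, Equiv.Perm.mul_apply, hh]; exact fix_inv6 hgy)
          have h2 := mul_mem (Subgroup.mem_zpowers g) this
          simpa using h2
        · have h2 : a = β := by
            by_contra h2
            exact H.h1 y a α β h1 hne h2 ha hα hβ
          subst h2
          have := step g⁻¹ h a l' m (fix_inv6 hgy) hh FreeGroup.norm_inv_eq eg' e
          have := ih _ (hn ▸ this) (g⁻¹⁻¹ * h) rfl (by
            rw [map_mul, Equiv.Perm.mul_apply, hh, inv_inv]; exact hgy)
          have h2 := mul_mem (inv_mem (Subgroup.mem_zpowers g)) this
          simpa using h2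
  have conj : ∀ k, Φ k x = x → c * k * c⁻¹ ∈ Subgroup.zpowers g := by
    intro k hk
    apply main _ _ rfl
    rw [hy, ← Equiv.Perm.mul_apply, ← map_mul]
    have : c * k * c⁻¹ * c = c * k := by group
    rw [this, map_mul, Equiv.Perm.mul_apply, hk]
  obtain ⟨i, hi⟩ := conj g₁ hg₁
  obtain ⟨j, hj⟩ := conj g₂ hg₂
  have hc : (c * g₁ * c⁻¹) * (c * g₂ * c⁻¹) = (c * g₂ * c⁻¹) * (c * g₁ * c⁻¹) := by
    rw [← hi, ← hj]
    simp only [← zpow_add, add_comm]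
  have : c * (g₁ * g₂) * c⁻¹ = c * (g₂ * g₁) * c⁻¹ := by
    calc _ = (c * g₁ * c⁻¹) * (c * g₂ * c⁻¹) := by group
      _ = _ := hc
      _ = _ := by group
  exact mul_left_cancel (mul_right_cancel this)

theorem pp_inj6 {X : Type*} {Φ : FreeGroup Bool →* Equiv.Perm X} {U : Bool × Bool → Set X}
    {sz : X → ℚ} (H : PP6 Φ U sz) (x : X) (hx : ∀ s, x ∉ U s) : Function.Injective Φ := by
  rw [injective_iff_map_eq_one]
  intro g hg
  by_contra hg1
  cases e : g.toWord with
  | nil => exact hg1 (FreeGroup.toWord_eq_nil_iff.1 e)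
  | cons a l => exact hx a (pp_head6 H (by rw [hg]; rfl) e)

def f6 (s : Bool × Bool) (x y : ℚ) : ℚ :=
  match s with
  | (true, true) => y
  | (true, false) => x
  | (false, true) => x - y + 1
  | (false, false) => x + y - 3

def M6 (x y : ℚ) : ℚ := max (max |x| |y|) 1

def nx6 (N : ℚ) (s : Bool × Bool) (x y : ℚ) : ℚ × ℚ :=
  match s with
  | (true, true) => (x - N * y, -N * x + (1 + N ^ 2) * y)
  | (true, false) => ((1 + N ^ 2) * x + N * y, N * x + y)
  | (false, true) => (x + 2 * N ^ 2 * (x - y + 1) + 2 * N * (x - 1),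
      y - 2 * N ^ 2 * (x - y + 1) - 2 * N * (y - 2))
  | (false, false) => (x + 2 * N ^ 2 * (x + y - 3) - 2 * N * (x - 1),
      y + 2 * N ^ 2 * (x + y - 3) + 2 * N * (y - 2))

theorem M6_x (x y : ℚ) : |x| ≤ M6 x y := (le_max_left _ _).trans (le_max_left _ _)
theorem M6_y (x y : ℚ) : |y| ≤ M6 x y := (le_max_right _ _).trans (le_max_left _ _)
theorem M6_1 (x y : ℚ) : 1 ≤ M6 x y := le_max_right _ _

theorem g1_6 (x y : ℚ) (s t r : Bool × Bool) (h1 : s ≠ t) (h2 : t ≠ r) (h3 : s ≠ r)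
    (hs : |f6 s x y| ≤ M6 x y / 10) (ht : |f6 t x y| ≤ M6 x y / 10)
    (hr : |f6 r x y| ≤ M6 x y / 10) : False := by
  have hM : M6 x y ≤ |x| ∨ M6 x y ≤ |y| ∨ M6 x y ≤ 1 := by
    unfold M6
    rcases le_total (max |x| |y|) 1 with h | h
    · simp [h]
    · rcases le_total |x| |y| with h' | h'
      · rw [max_eq_left h, max_eq_right h']; simp
      · rw [max_eq_left h, max_eq_left h']; simp
  have h0 := M6_1 x y
  generalize M6 x y = M at *
  have hM' : M ≤ x ∨ M ≤ -x ∨ M ≤ y ∨ M ≤ -y ∨ M ≤ 1 := by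
    simpa only [le_abs, or_assoc] using hM
  rw [abs_le] at hs ht hr
  obtain ⟨hs1, hs2⟩ := hs
  obtain ⟨ht1, ht2⟩ := ht
  obtain ⟨hr1, hr2⟩ := hr
  rcases s with ⟨_ | _, _ | _⟩ <;> rcases t with ⟨_ | _, _ | _⟩ <;>
    first
    | exact absurd rfl h1
    | (rcases r with ⟨_ | _, _ | _⟩ <;>
        first
        | exact absurd rfl h2
        | exact absurd rfl h3
        | (simp only [f6] at *
           rcases hM' with h | h | h | h | h <;> linarith))

theorem nx6_form (N : ℚ) (hN : 1000 ≤ N) (s : Bool × Bool) (x y : ℚ) :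
    ∃ E1 E2, |E1| ≤ 7 * (N * M6 x y) ∧ |E2| ≤ 7 * (N * M6 x y) ∧
      nx6 N s x y = match s with
      | (true, true) => (E1, N ^ 2 * f6 s x y + E2)
      | (true, false) => (N ^ 2 * f6 s x y + E1, E2)
      | (false, true) => (2 * (N ^ 2 * f6 s x y) + E1, -(2 * (N ^ 2 * f6 s x y)) + E2)
      | (false, false) => (2 * (N ^ 2 * f6 s x y) + E1, 2 * (N ^ 2 * f6 s x y) + E2) := by
  have hx := M6_x x y
  have hy := M6_y x y
  have h1 := M6_1 x y
  generalize M6 x y = M at *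
  have hNx : |N * x| ≤ N * M := by
    rw [abs_mul, abs_of_nonneg (by linarith : 0 ≤ N)]; gcongr
  have hNy : |N * y| ≤ N * M := by
    rw [abs_mul, abs_of_nonneg (by linarith : 0 ≤ N)]; gcongr
  have hNM : N ≤ N * M := by nlinarith
  have hNM' : 1000 * M ≤ N * M := by nlinarith
  rw [abs_le] at hx hy hNx hNy
  rcases s with ⟨_ | _, _ | _⟩
  · refine ⟨x - 2 * N * (x - 1), y + 2 * N * (y - 2), ?_, ?_, ?_⟩
    · rw [abs_le]; constructor <;> linarith
    · rw [abs_le]; constructor <;> linarith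
    · refine Prod.ext ?_ ?_ <;> simp only [nx6, f6] <;> ring
  · refine ⟨x + 2 * N * (x - 1), y - 2 * N * (y - 2), ?_, ?_, ?_⟩
    · rw [abs_le]; constructor <;> linarith
    · rw [abs_le]; constructor <;> linarith
    · refine Prod.ext ?_ ?_ <;> simp only [nx6, f6] <;> ring
  · refine ⟨x + N * y, N * x + y, ?_, ?_, ?_⟩
    · rw [abs_le]; constructor <;> linarith
    · rw [abs_le]; constructor <;> linarith
    · refine Prod.ext ?_ ?_ <;> simp only [nx6, f6] <;> ring
  · refine ⟨x - N * y, - N * x + y, ?_, ?_, ?_⟩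
    · rw [abs_le]; constructor <;> linarith
    · rw [abs_le]; constructor <;> linarith
    · refine Prod.ext ?_ ?_ <;> simp only [nx6, f6] <;> ring

theorem D6 (N : ℚ) (hN : 1000 ≤ N) (M f : ℚ) (hM : 1 ≤ M) (h : M / 10 < |f|) :
    100 * (N * M) ≤ |N ^ 2 * f| := by
  rw [abs_mul, abs_of_nonneg (by positivity : 0 ≤ N ^ 2)]
  have h1 : N ^ 2 * (M / 10) ≤ N ^ 2 * |f| := by gcongr
  have h2 : 1000 * (N * M) ≤ N * (N * M) := by
    have : 0 ≤ N * M := by nlinarith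
    gcongr
  nlinarith

theorem g2_6 (N : ℚ) (hN : 1000 ≤ N) (s : Bool × Bool) (x y : ℚ)
    (h : M6 x y / 10 < |f6 s x y|) :
    M6 x y < M6 (nx6 N s x y).1 (nx6 N s x y).2 := by
  obtain ⟨E1, E2, hE1, hE2, e⟩ := nx6_form N hN s x y
  have hD := D6 N hN _ _ (M6_1 x y) h
  have h1 := M6_1 x y
  have hx' := M6_x (nx6 N s x y).1 (nx6 N s x y).2
  have hy' := M6_y (nx6 N s x y).1 (nx6 N s x y).2
  have hNM' : 1000 * M6 x y ≤ N * M6 x y := by nlinarith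
  generalize M6 (nx6 N s x y).1 (nx6 N s x y).2 = M' at *
  generalize N ^ 2 * f6 s x y = D at *
  generalize M6 x y = M at *
  rw [abs_le] at hE1 hE2
  rw [e] at hx' hy'
  rw [abs_le] at hx' hy'
  rw [le_abs] at hD
  rcases s with ⟨_ | _, _ | _⟩ <;> simp only at hx' hy' <;> rcases hD with hD | hD <;> linarith

theorem g3_6 (N : ℚ) (hN : 1000 ≤ N) (s t : Bool × Bool) (x y : ℚ) (hst : t ≠ li6 s)
    (h : M6 x y / 10 < |f6 s x y|) :
    M6 (nx6 N s x y).1 (nx6 N s x y).2 / 10 < |f6 t (nx6 N s x y).1 (nx6 N s x y).2| := by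
  obtain ⟨E1, E2, hE1, hE2, e⟩ := nx6_form N hN s x y
  have hD := D6 N hN _ _ (M6_1 x y) h
  have h1 := M6_1 x y
  have hNM' : 1000 * M6 x y ≤ N * M6 x y := by nlinarith
  have hM' : M6 (nx6 N s x y).1 (nx6 N s x y).2 ≤ 2 * |N ^ 2 * f6 s x y| + 7 * (N * M6 x y) := by
    rw [e]
    generalize N ^ 2 * f6 s x y = D at *
    have := abs_le.1 (le_refl |D|)
    rw [abs_le] at hE1 hE2
    unfold M6
    refine max_le (max_le ?_ ?_) (by unfold M6 at *; linarith) <;> rw [abs_le] <;>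
    rcases s with ⟨_ | _, _ | _⟩ <;> simp only <;> constructor <;> unfold M6 at * <;> linarith
  refine lt_of_le_of_lt (div_le_div_of_nonneg_right hM' (by norm_num)) ?_
  rw [e]
  generalize N ^ 2 * f6 s x y = D at *
  generalize M6 x y = M at *
  rw [abs_le] at hE1 hE2
  rcases le_total 0 D with h0 | h0
  · rw [abs_of_nonneg h0] at hD ⊢
    rw [lt_abs]
    rcases s with ⟨_ | _, _ | _⟩ <;> rcases t with ⟨_ | _, _ | _⟩ <;>
    first
    | exact absurd rfl hst
    | (simp only [f6]; left; linarith)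
    | (simp only [f6]; right; linarith)
  · rw [abs_of_nonpos h0] at hD ⊢
    rw [lt_abs]
    rcases s with ⟨_ | _, _ | _⟩ <;> rcases t with ⟨_ | _, _ | _⟩ <;>
    first
    | exact absurd rfl hst
    | (simp only [f6]; left; linarith)
    | (simp only [f6]; right; linarith)

def Mem6 {K : Type*} [Field K] (N : ℤ) {n : ℕ} (g : Equiv.Perm (Fin n → K)) : Prop :=
  ∃ (A : Matrix.SpecialLinearGroup (Fin n) ℤ) (τ : Fin n → ℤ),
    (∀ i j, N ∣ A.1 i j - (1 : Matrix (Fin n) (Fin n) ℤ) i j) ∧ (∀ i, N ∣ τ i) ∧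
    ∀ x, g x = (A.1.map (Int.cast : ℤ → K)).mulVec x + fun i => ((τ i : K))

theorem map_mul6 {K : Type*} [Field K] {n : ℕ} (A B : Matrix (Fin n) (Fin n) ℤ) :
    (A * B).map (Int.cast : ℤ → K) = A.map (Int.cast : ℤ → K) * B.map (Int.cast : ℤ → K) :=
  Matrix.map_mul (f := Int.castRingHom K)

theorem map_vec6 {K : Type*} [Field K] {n : ℕ} (A : Matrix (Fin n) (Fin n) ℤ) (τ : Fin n → ℤ) :
    (A.map (Int.cast : ℤ → K)).mulVec (fun i => (τ i : K)) = fun i => ((A.mulVec τ i : ℤ) : K) := by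
  ext i
  simp [Matrix.mulVec, dotProduct]

theorem map_one6 {K : Type*} [Field K] {n : ℕ} :
    (1 : Matrix (Fin n) (Fin n) ℤ).map (Int.cast : ℤ → K) = 1 :=
  Matrix.map_one _ Int.cast_zero Int.cast_one

theorem mem_one6 {K : Type*} [Field K] (N : ℤ) {n : ℕ} :
    Mem6 N (1 : Equiv.Perm (Fin n → K)) :=
  ⟨1, 0, by simp, by simp, fun x => by
    rw [Matrix.SpecialLinearGroup.coe_one, map_one6, Matrix.one_mulVec]; ext; simp⟩

theorem dvd_mulVec6 (N : ℤ) {n : ℕ} (A : Matrix (Fin n) (Fin n) ℤ) (τ : Fin n → ℤ)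
    (h : ∀ i, N ∣ τ i) (i : Fin n) : N ∣ A.mulVec τ i := by
  rw [Matrix.mulVec, dotProduct]
  exact Finset.dvd_sum fun j _ => (h j).mul_left _

theorem dvd_mul6 (N : ℤ) {n : ℕ} (A C : Matrix (Fin n) (Fin n) ℤ)
    (h : ∀ i j, N ∣ C i j) (i j : Fin n) : N ∣ (A * C) i j := by
  rw [Matrix.mul_apply]
  exact Finset.dvd_sum fun k _ => (h k j).mul_left _

theorem mem_mul6 {K : Type*} [Field K] (N : ℤ) {n : ℕ} {g h : Equiv.Perm (Fin n → K)}
    (hg : Mem6 N g) (hh : Mem6 N h) : Mem6 N (g * h) := by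
  obtain ⟨A, τ, hA, hτ, eg⟩ := hg
  obtain ⟨B, σ, hB, hσ, eh⟩ := hh
  refine ⟨A * B, A.1.mulVec σ + τ, ?_, ?_, ?_⟩
  · intro i j
    have : (A * B).1 - 1 = A.1 * (B.1 - 1) + (A.1 - 1) := by
      rw [Matrix.SpecialLinearGroup.coe_mul, mul_sub, mul_one]; abel
    have e := congrFun (congrFun this i) j
    rw [Matrix.sub_apply] at e
    rw [e, Matrix.add_apply]
    exact dvd_add (dvd_mul6 N _ _ (fun i j => by rw [Matrix.sub_apply]; exact hB i j) i j)
      (by rw [Matrix.sub_apply]; exact hA i j)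
  · intro i
    exact dvd_add (dvd_mulVec6 N _ _ hσ i) (hτ i)
  · intro x
    rw [Equiv.Perm.mul_apply, eg, eh, Matrix.mulVec_add, map_vec6, Matrix.mulVec_mulVec,
      ← map_mul6, add_assoc]
    congr 1
    ext i; simp

theorem mem_inv6 {K : Type*} [Field K] (N : ℤ) {n : ℕ} {g : Equiv.Perm (Fin n → K)}
    (hg : Mem6 N g) : Mem6 N g⁻¹ := by
  obtain ⟨A, τ, hA, hτ, eg⟩ := hg
  have h1 : (A⁻¹).1 * A.1 = 1 := by
    rw [← Matrix.SpecialLinearGroup.coe_mul, inv_mul_cancel]; rfl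
  have h2 : A.1 * (A⁻¹).1 = 1 := by
    rw [← Matrix.SpecialLinearGroup.coe_mul, mul_inv_cancel]; rfl
  refine ⟨A⁻¹, (A⁻¹).1.mulVec (-τ), ?_, ?_, ?_⟩
  · intro i j
    have : (A⁻¹).1 - 1 = (A⁻¹).1 * (1 - A.1) := by
      rw [mul_sub, mul_one, h1]
    have e := congrFun (congrFun this i) j
    rw [Matrix.sub_apply] at e
    rw [e]
    exact dvd_mul6 N _ _ (fun i j => by
      rw [Matrix.sub_apply, ← dvd_neg, neg_sub]; exact hA i j) i j
  · exact dvd_mulVec6 N _ _ (fun i => (dvd_neg.2 (hτ i)))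
  · intro x
    rw [Equiv.Perm.inv_eq_iff_eq, eg, Matrix.mulVec_add, Matrix.mulVec_mulVec, ← map_mul6, h2,
      map_one6, Matrix.one_mulVec, map_vec6, Matrix.mulVec_mulVec, h2, Matrix.one_mulVec]
    ext i; simp

theorem exists_perm6 (K : Type*) [Field K] (N : ℤ) (m : ℕ) (A : Matrix (Fin 2) (Fin 2) ℤ)
    (τ : Fin 2 → ℤ) (hd : A.det = 1)
    (hA : ∀ i j, N ∣ A i j - (1 : Matrix (Fin 2) (Fin 2) ℤ) i j) (hτ : ∀ i, N ∣ τ i) :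
    ∃ g : Equiv.Perm (Fin (2 + m) → K), Mem6 N g ∧
      ∀ x i, g x (Fin.castAdd m i) =
        A i 0 * x (Fin.castAdd m 0) + A i 1 * x (Fin.castAdd m 1) + τ i := by
  let e := (finSumFinEquiv (m := 2) (n := m)).symm
  let B : Matrix (Fin (2 + m)) (Fin (2 + m)) ℤ := (Matrix.fromBlocks A 0 0 1).submatrix e e
  have hB : B.det = 1 := by
    rw [Matrix.det_submatrix_equiv_self, Matrix.det_fromBlocks_zero₂₁, hd]; simp
  let S : Matrix.SpecialLinearGroup (Fin (2 + m)) ℤ := ⟨B, hB⟩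
  have h1 : (S⁻¹).1 * B = 1 := by
    have : (S⁻¹ * S).1 = 1 := by rw [inv_mul_cancel]; rfl
    exact this
  have h2 : B * (S⁻¹).1 = 1 := by
    have : (S * S⁻¹).1 = 1 := by rw [mul_inv_cancel]; rfl
    exact this
  let σ : Fin (2 + m) → ℤ := Sum.elim τ 0 ∘ e
  let g : Equiv.Perm (Fin (2 + m) → K) :=
    { toFun := fun x => (B.map (Int.cast : ℤ → K)).mulVec x + fun i => ((σ i : K))
      invFun := fun x => ((S⁻¹).1.map (Int.cast : ℤ → K)).mulVec (x - fun i => ((σ i : K)))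
      left_inv := fun x => by
        simp only [add_sub_cancel_right]
        rw [Matrix.mulVec_mulVec, ← map_mul6, h1, map_one6, Matrix.one_mulVec]
      right_inv := fun x => by
        simp only
        rw [Matrix.mulVec_mulVec, ← map_mul6, h2, map_one6, Matrix.one_mulVec, sub_add_cancel] }
  refine ⟨g, ⟨S, σ, ?_, ?_, fun x => rfl⟩, ?_⟩
  · intro i j
    change N ∣ Matrix.fromBlocks A 0 0 1 (e i) (e j) - _
    obtain ⟨i, rfl⟩ := e.symm.surjective i
    obtain ⟨j, rfl⟩ := e.symm.surjective j
    rw [Equiv.apply_symm_apply, Equiv.apply_symm_apply, Matrix.one_apply]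
    simp only [EmbeddingLike.apply_eq_iff_eq]
    rcases i with i | i <;> rcases j with j | j
    · simpa [Matrix.one_apply] using hA i j
    · simp
    · simp
    · simp [Matrix.one_apply]
  · intro i
    change N ∣ Sum.elim τ 0 (e i)
    rcases e i with i | i
    · exact hτ i
    · simp
  · intro x i
    change (B.map (Int.cast : ℤ → K)).mulVec x (Fin.castAdd m i) + (σ (Fin.castAdd m i) : K) = _
    have hσ : σ (Fin.castAdd m i) = τ i := by simp [σ, e]
    rw [hσ]
    congr 1
    rw [Matrix.mulVec, dotProduct, Fin.sum_univ_add, Fin.sum_univ_two]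
    simp [B, e]

theorem val_int6 {K : Type*} [Field K] {v : K → ℝ} (hv : IsNAVal v) (k : ℤ) : v (k : K) ≤ 1 := by
  obtain ⟨h0, hz, hm, ha⟩ := hv
  have h1 : v 1 = 1 := by
    have := hm 1 1
    rw [mul_one] at this
    have hne : v 1 ≠ 0 := fun h => one_ne_zero ((hz 1).1 h)
    exact (mul_eq_left₀ hne).1 this.symm
  have hneg : v (-1) = 1 := by
    have := hm (-1) (-1)
    rw [neg_one_mul, neg_neg, h1] at this
    have h2 := h0 (-1)
    nlinarith
  have hnat : ∀ k : ℕ, v (k : K) ≤ 1 := by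
    intro k
    induction k with
    | zero => rw [Nat.cast_zero, (hz 0).2 rfl]; norm_num
    | succ k ih => rw [Nat.cast_succ]; exact (ha _ _).trans (max_le ih h1.le)
  rcases Int.eq_nat_or_neg k with ⟨n, rfl | rfl⟩
  · simpa using hnat n
  · have : (((-(n : ℤ)) : ℤ) : K) = -1 * (n : K) := by push_cast; ring
    rw [this, hm, hneg, one_mul]; exact hnat n

theorem val_dvd6 {K : Type*} [Field K] {v : K → ℝ} (hv : IsNAVal v) {N : ℤ} {ε : ℝ}
    (hN : v (N : K) ≤ ε) {k : ℤ} (h : N ∣ k) : v (k : K) ≤ ε := by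
  obtain ⟨c, rfl⟩ := h
  rw [Int.cast_mul, hv.2.2.1]
  have := val_int6 hv c
  have h0 := hv.1 (N : K)
  nlinarith [hv.1 (c : K)]

theorem mem_sa6 {K : Type*} [Field K] {v : K → ℝ} (hv : IsNAVal v) {N : ℤ} {ε : ℝ}
    (hN : v (N : K) ≤ ε) {n : ℕ} {g : Equiv.Perm (Fin n → K)} (hg : Mem6 N g) :
    MemSAZe v ε ⇑g := by
  obtain ⟨A, τ, hA, hτ, eg⟩ := hg
  refine ⟨A.1, τ, A.2, ?_, fun i => val_dvd6 hv hN (hτ i), eg⟩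
  intro i j
  have := val_dvd6 hv hN (hA i j)
  rw [← map_one6, Matrix.map_apply, ← Int.cast_sub]
  exact this

theorem exists_N6 {K : Type*} [Field K] {v : K → ℝ} (hv : IsNAVal v)
    (hp : ∃ p : ℕ, Nat.Prime p ∧ v ((p : K)) < 1) (ε : ℝ) (hε0 : 0 < ε) :
    ∃ N : ℤ, 1000 ≤ N ∧ v (N : K) ≤ ε := by
  obtain ⟨p, hp, hvp⟩ := hp
  obtain ⟨k, hk⟩ := exists_pow_lt_of_lt_one hε0 hvp
  have hpow : ∀ k : ℕ, 1 ≤ k → v ((p : K) ^ k) = v (p : K) ^ k := by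
    intro k hk
    induction k, hk using Nat.le_induction with
    | base => simp
    | succ k hk ih => rw [pow_succ, hv.2.2.1, ih, pow_succ]
  refine ⟨((p ^ (k + 1000) : ℕ) : ℤ), ?_, ?_⟩
  · have : k + 1000 < p ^ (k + 1000) := Nat.lt_pow_self hp.one_lt
    exact_mod_cast (by omega : 1000 ≤ p ^ (k + 1000))
  · push_cast
    rw [hpow _ (by omega)]
    exact (pow_le_pow_of_le_one (hv.1 _) hvp.le (by omega : k ≤ k + 1000)).trans hk.le

theorem exists_pi6 (K : Type*) [Field K] [CharZero K] :
    ∃ π : K →+ ℚ, π 1 = 1 ∧ ∀ (k : ℤ) (x : K), π (k * x) = k * π x := by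
  obtain ⟨f, hf⟩ := LinearMap.exists_leftInverse_of_injective (Algebra.linearMap ℚ K)
    (LinearMap.ker_eq_bot.2 (algebraMap ℚ K).injective)
  refine ⟨f.toAddMonoidHom, ?_, ?_⟩
  · have := LinearMap.congr_fun hf 1
    simpa using this
  · intro k x
    have : (k : K) * x = k • x := by simp
    rw [this, map_zsmul]; simp

theorem statement6 {K : Type*} [Field K] (v : K → ℝ) (hv : IsNAVal v)
    -- ch K = 0 and ch k = p > 0, i.e. the residue characteristic is a prime p with v p < 1
    (hchar0 : CharZero K) (hp : ∃ p : ℕ, Nat.Prime p ∧ v ((p : K)) < 1)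
    (n : ℕ) (hn : 2 ≤ n) (ε : ℝ) (hε0 : 0 < ε) (hε1 : ε ≤ 1) :
    ∃ a b : Equiv.Perm (Fin n → K),
      -- the free subgroup F₂ generated by {a, b} is contained in SA(n, ℤ, ε) …
      (∀ g ∈ Subgroup.closure {a, b}, MemSAZe v ε ⇑g) ∧
      -- … {a, b} is a free basis of F₂ …
      Function.Injective ⇑(FreeGroup.lift fun t : Bool => if t then a else b) ∧
      -- … and the action of F₂ on K^n is locally commutative
      (∀ g ∈ Subgroup.closure {a, b}, ∀ h ∈ Subgroup.closure {a, b},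
        ∀ x : Fin n → K, g x = x → h x = x → g * h = h * g) := by
  obtain ⟨m, rfl⟩ := Nat.exists_eq_add_of_le hn
  obtain ⟨N, hN, hvN⟩ := exists_N6 hv hp ε hε0
  obtain ⟨π, hπ1, hπ⟩ := exists_pi6 K
  obtain ⟨a, ha, fa⟩ := exists_perm6 K N m !![1 + N ^ 2, N; N, 1] 0
    (by rw [Matrix.det_fin_two_of]; ring)
    (by
      intro i j
      fin_cases i <;> fin_cases j <;> simp [pow_two]) (by simp)
  obtain ⟨b, hb, fb⟩ := exists_perm6 K N m
    !![1 + N * (2 * N - 2), N * (2 * N); N * (2 * N), 1 + N * (2 * N + 2)]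
    ![N * (2 - 6 * N), N * (-4 - 6 * N)]
    (by rw [Matrix.det_fin_two_of]; ring)
    (by
      intro i j
      fin_cases i <;> fin_cases j <;> simp)
    (by intro i; fin_cases i <;> simp)
  have hπi : ∀ k : ℤ, π (k : K) = k := fun k => by
    have := hπ k 1
    rwa [mul_one, hπ1, mul_one] at this
  let q : (Fin (2 + m) → K) → Fin 2 → ℚ := fun x i => π (x (Fin.castAdd m i))
  have qa : ∀ x, q (a x) 0 = (1 + N ^ 2) * q x 0 + N * q x 1 ∧ q (a x) 1 = N * q x 0 + q x 1 := by
    intro x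
    constructor
    · simp only [q]
      rw [fa, map_add, map_add, hπ, hπ, hπi]; simp
    · simp only [q]
      rw [fa, map_add, map_add, hπ, hπ, hπi]; simp
  have qb : ∀ x, q (b x) 0 = (1 + N * (2 * N - 2)) * q x 0 + N * (2 * N) * q x 1 + N * (2 - 6 * N) ∧
      q (b x) 1 = N * (2 * N) * q x 0 + (1 + N * (2 * N + 2)) * q x 1 + N * (-4 - 6 * N) := by
    intro x
    constructor
    · simp only [q]
      rw [fb, map_add, map_add, hπ, hπ, hπi]; simp
    · simp only [q]
      rw [fb, map_add, map_add, hπ, hπ, hπi]; simp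
  set Φ := FreeGroup.lift fun t : Bool => if t then a else b with hΦ
  have hNq : (1000 : ℚ) ≤ N := by exact_mod_cast hN
  have hnx : ∀ s x, (q (Φ (FreeGroup.mk [s])⁻¹ x) 0, q (Φ (FreeGroup.mk [s])⁻¹ x) 1) =
      nx6 N s (q x 0) (q x 1) := by
    intro s x
    rw [map_inv]
    rcases s with ⟨_ | _, _ | _⟩
    · have : (Φ (FreeGroup.mk [(false, false)]))⁻¹ = b := by simp [hΦ]
      rw [this, (qb x).1, (qb x).2]
      refine Prod.ext ?_ ?_ <;> simp only [nx6] <;> ring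
    · have : (Φ (FreeGroup.mk [(false, true)])) = b := by simp [hΦ]
      rw [this]
      obtain ⟨h1, h2⟩ := qb (b⁻¹ x)
      rw [← Equiv.Perm.mul_apply, mul_inv_cancel, Equiv.Perm.one_apply] at h1 h2
      rw [h1, h2]
      refine Prod.ext ?_ ?_ <;> simp only [nx6] <;> ring
    · have : (Φ (FreeGroup.mk [(true, false)]))⁻¹ = a := by simp [hΦ]
      rw [this, (qa x).1, (qa x).2]
      refine Prod.ext ?_ ?_ <;> simp only [nx6]
    · have : (Φ (FreeGroup.mk [(true, true)])) = a := by simp [hΦ]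
      rw [this]
      obtain ⟨h1, h2⟩ := qa (a⁻¹ x)
      rw [← Equiv.Perm.mul_apply, mul_inv_cancel, Equiv.Perm.one_apply] at h1 h2
      rw [h1, h2]
      refine Prod.ext ?_ ?_ <;> simp only [nx6] <;> ring
  have hn0 : ∀ s x, q (Φ (FreeGroup.mk [s])⁻¹ x) 0 = (nx6 N s (q x 0) (q x 1)).1 :=
    fun s x => congrArg Prod.fst (hnx s x)
  have hn1 : ∀ s x, q (Φ (FreeGroup.mk [s])⁻¹ x) 1 = (nx6 N s (q x 0) (q x 1)).2 :=
    fun s x => congrArg Prod.snd (hnx s x)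
  have H : PP6 Φ (fun s => {x | |f6 s (q x 0) (q x 1)| ≤ M6 (q x 0) (q x 1) / 10})
      (fun x => M6 (q x 0) (q x 1)) := by
    refine ⟨?_, ?_, ?_⟩
    · intro x s t r h1 h2 h3 hs ht hr
      exact g1_6 _ _ s t r h1 h2 h3 hs ht hr
    · intro x s hx
      simp only [Set.mem_ofPred_eq, not_le] at hx
      simp only [hn0, hn1]
      exact g2_6 N hNq s _ _ hx
    · intro x s t hst hx
      simp only [Set.mem_ofPred_eq, not_le] at hx ⊢
      simp only [hn0, hn1]
      exact g3_6 N hNq s t _ _ hst hx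
  have hcl : ∀ g ∈ Subgroup.closure {a, b}, ∃ w, Φ w = g := by
    intro g hg
    have : Subgroup.closure {a, b} ≤ Φ.range := by
      rw [Subgroup.closure_le]
      rintro _ (rfl | rfl)
      · exact ⟨FreeGroup.of true, by simp [hΦ]⟩
      · exact ⟨FreeGroup.of false, by simp [hΦ]⟩
    exact this hg
  refine ⟨a, b, ?_, ?_, ?_⟩
  · intro g hg
    apply mem_sa6 hv hvN
    induction hg using Subgroup.closure_induction with
    | mem x hx =>
      rcases hx with rfl | rfl
      · exact ha
      · exact hb
    | one => exact mem_one6 N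
    | mul x y _ _ hx hy => exact mem_mul6 N hx hy
    | inv x _ hx => exact mem_inv6 N hx
  · -- a point with no bad letters: (50, 100)
    let x0 : Fin (2 + m) → K := fun i => if i = Fin.castAdd m 0 then ((50 : ℤ) : K) else ((100 : ℤ) : K)
    have e0 : q x0 0 = 50 := by
      simp only [q, x0, if_true]; rw [hπi]; norm_num
    have e1 : q x0 1 = 100 := by
      have : (Fin.castAdd m 1 : Fin (2 + m)) ≠ Fin.castAdd m 0 := by simp [Fin.ext_iff]
      simp only [q, x0, if_neg this]; rw [hπi]; norm_num
    refine pp_inj6 H x0 ?_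
    intro s
    simp only [Set.mem_ofPred_eq, not_le, e0, e1]
    rcases s with ⟨_ | _, _ | _⟩ <;> norm_num [f6, M6, abs_of_pos, abs_of_neg]
  · intro g hg h hh x hgx hhx
    obtain ⟨w, rfl⟩ := hcl g hg
    obtain ⟨u, rfl⟩ := hcl h hh
    rw [← map_mul, ← map_mul, pp_main6 H x w u hgx hhx]
end

section
/- Let (K,|·|) be a non-Archimedean nontrivially valued field whose residue field k satisfies ch K = ch k. Then for every n ≥ 2 and every ε ∈ (0,1] there exists a free subgroup of rank two F₂ ≤ SA(n,D_K,ε) whose action on K^n is locally commutative. -/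
/-- `f ∈ SA(n, D_K, ε)`: `f` is the affine map `x ↦ A x + τ` with
`A ∈ SL(n, D_K, ε)` and `τ ∈ D_K^n` with `v (τ i) ≤ ε` for all `i`. -/
def MemSAe {K : Type*} [Field K] (v : K → ℝ) (ε : ℝ) {n : ℕ}
    (f : (Fin n → K) → Fin n → K) : Prop :=
  ∃ (A : Matrix (Fin n) (Fin n) K) (τ : Fin n → K),
    (∀ i j, v (A i j) ≤ 1) ∧ A.det = 1 ∧
    (∀ i j, v (A i j - (1 : Matrix (Fin n) (Fin n) K) i j) ≤ ε) ∧
    (∀ i, v (τ i) ≤ 1) ∧ (∀ i, v (τ i) ≤ ε) ∧ ∀ x, f x = A.mulVec x + τ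

namespace S7

/-- inverse letter -/
def flp (s : Bool × Bool) : Bool × Bool := (s.1, !s.2)

/-- the permutation attached to a letter (inverse of its value) -/
def ltr {X : Type*} (f : Bool → Equiv.Perm X) (s : Bool × Bool) : Equiv.Perm X :=
  (cond s.2 (f s.1) (f s.1)⁻¹)⁻¹

/-- follow the path of a word -/
def run {X : Type*} (f : Bool → Equiv.Perm X) : List (Bool × Bool) → X → X
  | [], x => x
  | s :: L, x => run f L (ltr f s x)

lemma run_append {X : Type*} (f : Bool → Equiv.Perm X) (L M : List (Bool × Bool)) (x : X) :
    run f (L ++ M) x = run f M (run f L x) := by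
  induction L generalizing x with
  | nil => rfl
  | cons s L ih => exact ih _

lemma run_eq {X : Type*} (f : Bool → Equiv.Perm X) (L : List (Bool × Bool)) (x : X) :
    run f L x = (FreeGroup.lift f (FreeGroup.mk L))⁻¹ x := by
  induction L generalizing x with
  | nil => rfl
  | cons s L ih =>
    rw [run, ih, FreeGroup.lift_mk, FreeGroup.lift_mk, List.map_cons, List.prod_cons, mul_inv_rev]
    rfl

lemma ltr_flp {X : Type*} (f : Bool → Equiv.Perm X) (s : Bool × Bool) (x : X) :
    ltr f (flp s) (ltr f s x) = x := by
  rcases s with ⟨s, _ | _⟩ <;> simp [ltr, flp]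

lemma ne_flp {s t : Bool × Bool} (h : s.1 = t.1 → s.2 = t.2) : flp s ≠ t := by
  rintro rfl
  simp [flp] at h

lemma flp_flp (s : Bool × Bool) : flp (flp s) = s := by simp [flp]

/-- the combinatorial hypothesis -/
structure Good {X Γ : Type*} [LinearOrder Γ] (f : Bool → Equiv.Perm X) (N : X → Γ) : Prop where
  c1 : ∀ s t : Bool × Bool, s ≠ t → ∀ y, N (ltr f s y) < N y → N y < N (ltr f t y)
  c2 : ∀ s t r : Bool × Bool, s ≠ t → s ≠ r → t ≠ r → ∀ y, N (ltr f s y) ≤ N y →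
    N (ltr f t y) ≤ N y → N y < N (ltr f r y)

section
variable {X Γ : Type*} [LinearOrder Γ] {f : Bool → Equiv.Perm X} {N : X → Γ}

open FreeGroup

lemma up_aux (H : Good f N) (L : List (Bool × Bool)) : ∀ (s : Bool × Bool) (y : X),
    IsReduced (s :: L) → N y < N (ltr f s y) → N (ltr f s y) ≤ N (run f L (ltr f s y)) := by
  induction L with
  | nil => intro s y _ _; exact le_rfl
  | cons t L ih =>
    intro s y hr h
    rw [isReduced_cons_cons] at hr
    have h1 := H.c1 (flp s) t (ne_flp hr.1) (ltr f s y) (by rwa [ltr_flp])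
    exact h1.le.trans (ih t _ hr.2 h1)

lemma up (H : Good f N) {L : List (Bool × Bool)} {s : Bool × Bool} {y : X}
    (hr : IsReduced (s :: L)) (h : N y < N (ltr f s y)) : N y < N (run f (s :: L) y) :=
  h.trans_le (up_aux H L s y hr h)

lemma prefix_aux (H : Good f N) (L : List (Bool × Bool)) :
    ∀ (M : List (Bool × Bool)) (p : Bool × Bool) (y : X),
    IsReduced (p :: L) → IsReduced (p :: M) → N (ltr f (flp p) y) ≤ N y →
    N (run f L y) ≤ N y → N (run f M y) ≤ N y → L <+: M ∨ M <+: L := by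
  induction L with
  | nil => intro M _ _ _ _ _ _ _; exact Or.inl List.nil_prefix
  | cons s L ih =>
    intro M p y hL hM h0 h1 h2
    cases M with
    | nil => exact Or.inr List.nil_prefix
    | cons t M =>
      rw [isReduced_cons_cons] at hL hM
      have hs : N (ltr f s y) ≤ N y := by
        by_contra hc
        exact absurd (up H hL.2 (not_le.1 hc)) (not_lt.2 h1)
      have ht : N (ltr f t y) ≤ N y := by
        by_contra hc
        exact absurd (up H hM.2 (not_le.1 hc)) (not_lt.2 h2)
      have hst : s = t := by
        by_contra hne
        exact absurd (H.c2 _ _ _ (ne_flp hL.1) (ne_flp hM.1) hne y h0 hs) (not_lt.2 ht)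
      subst hst
      have hge : N y ≤ N (ltr f s y) := by
        by_contra hc
        exact absurd (H.c1 _ _ (ne_flp hL.1).symm y (not_le.1 hc)) (not_lt.2 h0)
      rcases ih M s (ltr f s y) hL.2 hM.2 (by rwa [ltr_flp]) (h1.trans hge) (h2.trans hge) with h | h
      · exact Or.inl ((List.prefix_cons_inj s).2 h)
      · exact Or.inr ((List.prefix_cons_inj s).2 h)

lemma first_le (H : Good f N) {u : FreeGroup Bool} {x : X} (hu : FreeGroup.lift f u x = x)
    {s : Bool × Bool} {L : List (Bool × Bool)} (hL : u.toWord = s :: L) :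
    N (ltr f s x) ≤ N x := by
  by_contra hc
  have := up H (hL ▸ isReduced_toWord) (not_le.1 hc)
  rw [run_eq, ← hL, mk_toWord, Equiv.Perm.inv_eq_iff_eq.2 hu.symm] at this
  exact lt_irrefl _ this

lemma run_word {u : FreeGroup Bool} {x : X} (hu : FreeGroup.lift f u x = x) :
    run f u.toWord x = x := by
  rw [run_eq, mk_toWord, Equiv.Perm.inv_eq_iff_eq.2 hu.symm]

lemma lift_inv_fix {u : FreeGroup Bool} {x : X} (hu : FreeGroup.lift f u x = x) :
    FreeGroup.lift f u⁻¹ x = x := by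
  rw [_root_.map_inv, Equiv.Perm.inv_eq_iff_eq.2 hu.symm]

lemma inv_word {u : FreeGroup Bool} (hu : u ≠ 1) : ∃ s L, u.toWord = s :: L := by
  cases h : u.toWord with
  | nil => exact absurd (toWord_eq_nil_iff.1 h) hu
  | cons s L => exact ⟨s, L, rfl⟩

/-- the descending case -/
lemma desc (H : Good f N) {u : FreeGroup Bool} {x : X} (hu : FreeGroup.lift f u x = x)
    (hu1 : u ≠ 1) {s : Bool × Bool} (hs : N (ltr f s x) < N x) :
    ∃ u' : FreeGroup Bool, u'.norm < u.norm ∧ u = mk [s] * u' * (mk [s])⁻¹ := by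
  obtain ⟨t, L, hL⟩ := inv_word hu1
  obtain ⟨r, M, hM⟩ := inv_word (inv_ne_one.2 hu1)
  have h1 := first_le H hu hL
  have h2 := first_le H (lift_inv_fix hu) hM
  have e1 : s = t := by
    by_contra hne
    exact absurd (H.c1 _ _ hne _ hs) (not_lt.2 h1)
  have e2 : s = r := by
    by_contra hne
    exact absurd (H.c1 _ _ hne _ hs) (not_lt.2 h2)
  subst e1 e2
  rw [toWord_inv] at hM
  have hM' : u.toWord = invRev M ++ [flp s] := by
    rw [← invRev_invRev (L₁ := u.toWord), hM, invRev_cons]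
    simp [invRev, flp]
  cases hM2 : invRev M with
  | nil =>
    rw [hM2, hL] at hM'
    simp at hM'
    have := hM'.1
    simp [flp, Prod.ext_iff] at this
  | cons q Q =>
    rw [hM2, hL] at hM'
    simp at hM'
    obtain ⟨rfl, rfl⟩ := hM'
    refine ⟨mk Q, ?_, ?_⟩
    · have : u.norm = u.toWord.length := rfl
      rw [this, hL]
      refine norm_mk_le.trans_lt ?_
      simp
    · rw [← mk_toWord (x := u), hL, inv_mk, mul_mk, mul_mk]
      simp [invRev, flp]

lemma same_first (H : Good f N) {u w : FreeGroup Bool} {x : X} (hu : FreeGroup.lift f u x = x)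
    (hw : FreeGroup.lift f w x = x) (hx : ∀ s, N x ≤ N (ltr f s x)) {s : Bool × Bool}
    {L M : List (Bool × Bool)} (hL : u.toWord = s :: L) (hM : w.toWord = s :: M) :
    u.toWord <+: w.toWord ∨ w.toWord <+: u.toWord := by
  have hu' := run_word hu
  have hw' := run_word hw
  rw [hL] at hu' ⊢
  rw [hM] at hw' ⊢
  rw [run] at hu' hw'
  rcases prefix_aux H L M s (ltr f s x) (hL ▸ isReduced_toWord) (hM ▸ isReduced_toWord)
    (by rw [ltr_flp]; exact hx s) (by rw [hu']; exact hx s) (by rw [hw']; exact hx s) with h | h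
  · exact Or.inl ((List.prefix_cons_inj s).2 h)
  · exact Or.inr ((List.prefix_cons_inj s).2 h)

lemma split_prefix {u w : FreeGroup Bool} {x : X} (hu : FreeGroup.lift f u x = x)
    (hw : FreeGroup.lift f w x = x) (hu1 : u ≠ 1) (h : u.toWord <+: w.toWord) :
    ∃ w' : FreeGroup Bool, w'.norm < w.norm ∧ w = u * w' ∧ FreeGroup.lift f w' x = x := by
  obtain ⟨M, hM⟩ := h
  have hw2 : w = u * mk M := by
    rw [← mk_toWord (x := w), ← hM, ← mul_mk, mk_toWord]
  refine ⟨mk M, ?_, hw2, ?_⟩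
  · have : w.norm = w.toWord.length := rfl
    rw [this, ← hM]
    refine norm_mk_le.trans_lt ?_
    obtain ⟨s, L, hL⟩ := inv_word hu1
    rw [hL]; simp
  · have : mk M = u⁻¹ * w := by rw [hw2]; group
    rw [this, _root_.map_mul, Equiv.Perm.mul_apply, hw, lift_inv_fix hu]

theorem comm_aux (H : Good f N) (n : ℕ) : ∀ (u w : FreeGroup Bool) (x : X),
    u.norm + w.norm < n → FreeGroup.lift f u x = x → FreeGroup.lift f w x = x → Commute u w := by
  induction n with
  | zero => intro u w x h; omega
  | succ n ih =>
    intro u w x hn hu hw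
    by_cases hu1 : u = 1
    · rw [hu1]; exact Commute.one_left _
    by_cases hw1 : w = 1
    · rw [hw1]; exact Commute.one_right _
    by_cases hd : ∃ s, N (ltr f s x) < N x
    · obtain ⟨s, hs⟩ := hd
      obtain ⟨u', hu', rfl⟩ := desc H hu hu1 hs
      obtain ⟨w', hw', rfl⟩ := desc H hw hw1 hs
      have key : ∀ z : FreeGroup Bool, FreeGroup.lift f (mk [s] * z * (mk [s])⁻¹) x = x →
          FreeGroup.lift f z (ltr f s x) = ltr f s x := by
        intro z hz
        have e : ltr f s = (FreeGroup.lift f (mk [s]))⁻¹ := by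
          ext y; exact run_eq f [s] y
        rw [_root_.map_mul, _root_.map_mul, Equiv.Perm.mul_apply, Equiv.Perm.mul_apply, _root_.map_inv] at hz
        rw [e, Equiv.Perm.eq_inv_iff_eq]
        exact hz
      have := ih u' w' (ltr f s x) (by omega) (key _ hu) (key _ hw)
      exact (Commute.conj_iff (mk [s])).2 this
    · push Not at hd
      have same : ∀ u w : FreeGroup Bool, u.norm + w.norm < n + 1 → FreeGroup.lift f u x = x →
          FreeGroup.lift f w x = x → u ≠ 1 → w ≠ 1 →
          (u.toWord <+: w.toWord ∨ w.toWord <+: u.toWord) → Commute u w := by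
        intro u w hn hu hw hu1 hw1 hp
        rcases hp with hp | hp
        · obtain ⟨w', h1, rfl, h3⟩ := split_prefix hu hw hu1 hp
          exact (Commute.refl u).mul_right (ih u w' x (by omega) hu h3)
        · obtain ⟨w', h1, rfl, h3⟩ := split_prefix hw hu hw1 hp
          exact (Commute.refl w).mul_left (ih w' w x (by omega) h3 hw)
      obtain ⟨s, L, hL⟩ := inv_word hu1
      obtain ⟨t, M, hM⟩ := inv_word hw1
      obtain ⟨r, L', hL'⟩ := inv_word (inv_ne_one.2 hu1)
      have hui := lift_inv_fix hu
      by_cases hst : s = t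
      · subst hst
        exact same u w hn hu hw hu1 hw1 (same_first H hu hw hd hL hM)
      by_cases hrt : r = t
      · subst hrt
        have := same u⁻¹ w (by rwa [norm_inv_eq]) hui hw (inv_ne_one.2 hu1) hw1
          (same_first H hui hw hd hL' hM)
        exact Commute.inv_left_iff.1 this
      have hrs : s = r := by
        by_contra hne
        exact absurd (H.c2 s t r hst hne (Ne.symm hrt) x (first_le H hu hL) (first_le H hw hM))
          (not_lt.2 (first_le H hui hL'))
      subst hrs
      exfalso
      have hlen : u.toWord.length = u⁻¹.toWord.length := by
        rw [toWord_inv, invRev_length]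
      have heq : u.toWord = u⁻¹.toWord := by
        rcases same_first H hu hui hd hL hL' with h | h
        · exact h.eq_of_length hlen
        · exact (h.eq_of_length hlen.symm).symm
      have h2 : u = u⁻¹ := toWord_injective heq
      have h3 : u ^ 2 = 1 := by
        rw [pow_two]; nth_rewrite 1 [h2]; group
      exact hu1 (pow_eq_one_iff_left (by norm_num) |>.1 h3)

theorem inj_aux (H : Good f N) (hp : ∀ s : Bool × Bool, ∃ x, N x < N (ltr f s x)) :
    Function.Injective (FreeGroup.lift f) := by
  rw [injective_iff_map_eq_one]
  intro u hu
  by_contra hu1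
  obtain ⟨s, L, hL⟩ := inv_word hu1
  obtain ⟨x, hx⟩ := hp s
  exact absurd (first_le H (x := x) (by rw [hu]; rfl) hL) (not_le.2 hx)

end
end S7

namespace S7

section Val
variable {K : Type*} [Field K] {v : K → ℝ}

lemma v_zero (hv : IsNAVal v) : v 0 = 0 := (hv.2.1 0).2 rfl

lemma v_one (hv : IsNAVal v) : v 1 = 1 := by
  have h := hv.2.2.1 1 1
  have h0 : v 1 ≠ 0 := fun h => one_ne_zero ((hv.2.1 1).1 h)
  rw [mul_one] at h
  field_simp at h
  exact h.symm

lemma v_neg (hv : IsNAVal v) (x : K) : v (-x) = v x := by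
  have h := hv.2.2.1 (-1) (-1)
  rw [neg_mul_neg, one_mul, v_one hv] at h
  have h1 : v (-1) = 1 := by
    have := hv.1 (-1)
    nlinarith
  have := hv.2.2.1 (-1) x
  rw [h1, one_mul, neg_one_mul] at this
  exact this

lemma v_add_le (hv : IsNAVal v) {x y : K} {r : ℝ} (hx : v x ≤ r) (hy : v y ≤ r) :
    v (x + y) ≤ r := (hv.2.2.2 x y).trans (max_le hx hy)

lemma v_sub_le (hv : IsNAVal v) {x y : K} {r : ℝ} (hx : v x ≤ r) (hy : v y ≤ r) :
    v (x - y) ≤ r := by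
  rw [sub_eq_add_neg]; exact v_add_le hv hx (by rwa [v_neg hv])

lemma v_sum_le (hv : IsNAVal v) {ι : Type*} (s : Finset ι) (g : ι → K) {r : ℝ} (hr : 0 ≤ r)
    (h : ∀ i ∈ s, v (g i) ≤ r) : v (∑ i ∈ s, g i) ≤ r := by
  classical
  induction s using Finset.induction_on with
  | empty => simpa [v_zero hv] using hr
  | insert a s ha ih =>
    rw [Finset.sum_insert ha]
    exact v_add_le hv (h a (by simp)) (ih fun i hi => h i (by simp [hi]))

lemma v_mul_le (hv : IsNAVal v) {x y : K} {r s : ℝ} (hx : v x ≤ r) (hy : v y ≤ s) :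
    v (x * y) ≤ r * s := by
  rw [hv.2.2.1]
  exact mul_le_mul hx hy (hv.1 _) ((hv.1 _).trans hx)

lemma exists_val (hv : IsNAVal v) (hchar : ∀ m : ℕ, (m : K) ≠ 0 → v ((m : K)) = 1)
    (t : K) (ht0 : t ≠ 0) (ht1 : v t < 1) :
    ∃ V : ValuationSubring K, t ∉ V := by
  by_contra! hc
  have hmem : t ∈ (⨅ V : {V : ValuationSubring K // (∅ : Set K) ⊆ V.toSubring},
      V.1.toSubring) := by
    rw [Subring.mem_iInf]
    exact fun V => hc V.1
  rw [iInf_valuationSubring_superset] at hmem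
  have hint : IsIntegral (Subring.closure (∅ : Set K)) t := hmem
  have hS : ∀ s : Subring.closure (∅ : Set K), (s : K) ≠ 0 → v s = 1 := by
    rintro ⟨s, hs⟩ h0
    rw [Subring.closure_empty, Subring.mem_bot] at hs
    obtain ⟨m, rfl⟩ := hs
    simp only at h0 ⊢
    rcases Int.natAbs_eq m with h | h
    · rw [h] at h0 ⊢
      simpa using hchar m.natAbs (by simpa using h0)
    · rw [h] at h0 ⊢
      push_cast at h0 ⊢
      rw [v_neg hv]
      simpa using hchar m.natAbs (by simpa using h0)
  have hS1 : ∀ s : Subring.closure (∅ : Set K), v s ≤ 1 := by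
    intro s
    by_cases h : (s : K) = 0
    · rw [h, v_zero hv]; exact zero_le_one
    · exact (hS s h).le
  have hle : ∀ p : Polynomial (Subring.closure (∅ : Set K)), v (Polynomial.aeval t p) ≤ 1 := by
    intro p
    rw [Polynomial.aeval_eq_sum_range]
    refine v_sum_le hv _ _ zero_le_one fun i hi => ?_
    have h2 : v (t ^ i) ≤ 1 := by
      clear hi
      induction i with
      | zero => rw [pow_zero, v_one hv]
      | succ i ih => rw [pow_succ]; simpa using v_mul_le hv ih ht1.le
    have h3 := v_mul_le hv (hS1 (p.coeff i)) h2
    rw [one_mul] at h3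
    exact h3
  have hne : ∀ (n : ℕ) (p : Polynomial (Subring.closure (∅ : Set K))), p.natDegree < n → p ≠ 0 →
      Polynomial.aeval t p ≠ 0 := by
    intro n
    induction n with
    | zero => intro p h; omega
    | succ n ih =>
      intro p hn hp h0
      have hdec := Polynomial.divX_mul_X_add p
      have he : Polynomial.aeval t p.divX * t + (p.coeff 0 : K) = 0 := by
        rw [← h0]
        conv_rhs => rw [← hdec]
        simp [Algebra.algebraMap_eq_smul_one, Subring.smul_def]
      by_cases hc0 : p.coeff 0 = 0
      · have hd : p.divX ≠ 0 := by
          intro hd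
          rw [hd, hc0] at hdec
          simp at hdec
          exact hp hdec.symm
        rw [hc0] at he
        simp [ht0] at he
        refine ih p.divX ?_ hd he
        have hdeg : p.natDegree ≠ 0 := by
          intro hz
          exact hd (by rw [Polynomial.eq_C_of_natDegree_eq_zero hz, Polynomial.divX_C])
        rw [Polynomial.natDegree_divX_eq_natDegree_tsub_one]
        omega
      · have h1 := hS (p.coeff 0) (by simpa using hc0)
        have h2 : (p.coeff 0 : K) = -(Polynomial.aeval t p.divX * t) := by
          linear_combination he
        rw [h2, v_neg hv, hv.2.2.1] at h1
        have := hle p.divX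
        have := hv.1 (Polynomial.aeval t p.divX)
        have := hv.1 t
        nlinarith
  obtain ⟨p, hp, hp0⟩ := hint
  exact hne _ p (Nat.lt_succ_self _) hp.ne_zero hp0

end Val

section SA
variable {K : Type*} [Field K] {v : K → ℝ} {n : ℕ}
open Matrix

lemma mulVec_le (hv : IsNAVal v) {A : Matrix (Fin n) (Fin n) K} {x : Fin n → K} {r s : ℝ}
    (hr : 0 ≤ r) (hs : 0 ≤ s)
    (hA : ∀ i j, v (A i j) ≤ r) (hx : ∀ i, v (x i) ≤ s) (i : Fin n) : v ((A *ᵥ x) i) ≤ r * s := by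
  rw [mulVec, dotProduct]
  exact v_sum_le hv _ _ (mul_nonneg hr hs) fun j _ => v_mul_le hv (hA i j) (hx j)

lemma mul_le (hv : IsNAVal v) {A B : Matrix (Fin n) (Fin n) K} {r s : ℝ}
    (hr : 0 ≤ r) (hs : 0 ≤ s)
    (hA : ∀ i j, v (A i j) ≤ r) (hB : ∀ i j, v (B i j) ≤ s) (i j : Fin n) :
    v ((A * B) i j) ≤ r * s := by
  rw [mul_apply]
  exact v_sum_le hv _ _ (mul_nonneg hr hs) fun k _ => v_mul_le hv (hA i k) (hB k j)

lemma v_one_apply (hv : IsNAVal v) (i j : Fin n) : v ((1 : Matrix (Fin n) (Fin n) K) i j) ≤ 1 := by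
  rw [one_apply]
  split_ifs
  · rw [v_one hv]
  · rw [v_zero hv]; exact zero_le_one

lemma mk_mem (hv : IsNAVal v) {ε : ℝ} (hε1 : ε ≤ 1) {f : (Fin n → K) → Fin n → K}
    (A : Matrix (Fin n) (Fin n) K) (τ : Fin n → K) (hd : A.det = 1)
    (hA : ∀ i j, v ((A - 1) i j) ≤ ε) (hτ : ∀ i, v (τ i) ≤ ε) (hf : ∀ x, f x = A *ᵥ x + τ) :
    MemSAe v ε f := by
  refine ⟨A, τ, fun i j => ?_, hd, hA, fun i => (hτ i).trans hε1, hτ, hf⟩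
  have : A i j = (A - 1) i j + (1 : Matrix (Fin n) (Fin n) K) i j := by simp
  rw [this]
  exact v_add_le hv ((hA i j).trans hε1) (v_one_apply hv i j)

lemma mem_one (hv : IsNAVal v) {ε : ℝ} (hε0 : 0 ≤ ε) (hε1 : ε ≤ 1) :
    MemSAe v ε (⇑(1 : Equiv.Perm (Fin n → K))) :=
  mk_mem hv hε1 1 0 (by simp) (by simp [v_zero hv, hε0]) (by simp [v_zero hv, hε0]) (by simp)

lemma mem_mul (hv : IsNAVal v) {ε : ℝ} (hε0 : 0 ≤ ε) (hε1 : ε ≤ 1) {g h : Equiv.Perm (Fin n → K)}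
    (hg : MemSAe v ε g) (hh : MemSAe v ε h) : MemSAe v ε (⇑(g * h)) := by
  obtain ⟨A, τ, hA1, hAd, hA, hτ1, hτ, hgf⟩ := hg
  obtain ⟨B, σ, hB1, hBd, hB, hσ1, hσ, hhf⟩ := hh
  refine mk_mem hv hε1 (A * B) (A *ᵥ σ + τ) (by rw [det_mul, hAd, hBd, one_mul]) ?_ ?_ ?_
  · intro i j
    have : A * B - 1 = A * (B - 1) + (A - 1) := by rw [Matrix.mul_sub, Matrix.mul_one]; abel
    rw [this, Matrix.add_apply]
    exact v_add_le hv (by simpa using mul_le hv zero_le_one hε0 hA1 (B := B - 1) hB i j) (hA i j)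
  · intro i
    exact v_add_le hv (by simpa using mulVec_le hv zero_le_one hε0 hA1 hσ i) (hτ i)
  · intro x
    rw [Equiv.Perm.mul_apply, hgf, hhf, mulVec_add, mulVec_mulVec, add_assoc]

lemma mem_conj (hv : IsNAVal v) {ε : ℝ} (hε0 : 0 ≤ ε) (hε1 : ε ≤ 1)
    {c g : Equiv.Perm (Fin n → K)} (hc : MemSAe v 1 c) (hc' : MemSAe v 1 (⇑c⁻¹))
    (hg : MemSAe v ε g) : MemSAe v ε (⇑(c * g * c⁻¹)) := by
  obtain ⟨A, τ, hA1, hAd, hA, hτ1, hτ, hgf⟩ := hg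
  obtain ⟨C, σ, hC1, hCd, -, hσ1, -, hcf⟩ := hc
  obtain ⟨C', σ', hC1', hCd', -, hσ1', -, hcf'⟩ := hc'
  have hid : ∀ x, C *ᵥ (C' *ᵥ x + σ') + σ = x := by
    intro x; rw [← hcf', ← hcf]; simp
  have h0 : C *ᵥ σ' + σ = 0 := by simpa using hid 0
  have hCC : C * C' = 1 := by
    ext i j
    have := hid (Pi.single j 1)
    rw [mulVec_add, add_assoc, h0, add_zero, mulVec_mulVec] at this
    have := congrFun this i
    rw [mulVec_single_one] at this
    simpa [one_apply, Pi.single_apply] using this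
  refine mk_mem hv hε1 (C * A * C') (C *ᵥ ((A - 1) *ᵥ σ') + C *ᵥ τ)
    (by rw [det_mul, det_mul, hAd, hCd, hCd']; simp) ?_ ?_ ?_
  · intro i j
    have : C * A * C' - 1 = C * (A - 1) * C' := by
      rw [Matrix.mul_sub, Matrix.sub_mul, Matrix.mul_one, hCC]
    rw [this]
    simpa using mul_le hv hε0 zero_le_one
      (fun i j => by simpa using mul_le hv zero_le_one hε0 hC1 (B := A - 1) hA i j) hC1' i j
  · intro i
    refine v_add_le hv ?_ (by simpa using mulVec_le hv zero_le_one hε0 hC1 hτ i)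
    have h1 : ∀ i, v (((A - 1) *ᵥ σ') i) ≤ ε := fun i => by
      have := mulVec_le hv hε0 zero_le_one (A := A - 1) hA hσ1' i
      rwa [mul_one] at this
    have h2 := mulVec_le hv zero_le_one hε0 hC1 h1 i
    rwa [one_mul] at h2
  · intro x
    rw [Equiv.Perm.mul_apply, Equiv.Perm.mul_apply, hcf', hgf, hcf, eq_neg_of_add_eq_zero_right h0]
    simp only [mulVec_add, sub_mulVec, one_mulVec, mulVec_sub, ← mulVec_mulVec]
    abel

/-- elementary shear -/
def E (i j : Fin n) (h : i ≠ j) (c : K) : Equiv.Perm (Fin n → K) where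
  toFun x := x + Pi.single i (c * x j)
  invFun x := x + Pi.single i (-c * x j)
  left_inv x := by
    simp [Pi.single_eq_of_ne h.symm, add_assoc, ← Pi.single_add]
  right_inv x := by
    simp [Pi.single_eq_of_ne h.symm, add_assoc, ← Pi.single_add]

lemma E_inv (i j : Fin n) (h : i ≠ j) (c : K) : (E i j h c)⁻¹ = E i j h (-c) := by
  ext x; rfl

lemma E_same (i j : Fin n) (h : i ≠ j) (c : K) (x : Fin n → K) :
    E i j h c x i = x i + c * x j := by simp [E]

lemma E_other (i j : Fin n) (h : i ≠ j) (c : K) (x : Fin n → K) :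
    E i j h c x j = x j := by simp [E, Pi.single_eq_of_ne h.symm]

lemma E_mem (hv : IsNAVal v) {ε : ℝ} (hε0 : 0 ≤ ε) (hε1 : ε ≤ 1) (i j : Fin n) (h : i ≠ j) (c : K)
    (hc : v c ≤ ε) : MemSAe v ε (⇑(E i j h c)) := by
  refine mk_mem hv hε1 (transvection i j c) 0 (det_transvection_of_ne i j h c) ?_
    (by simp [v_zero hv, hε0]) ?_
  · intro a b
    simp only [transvection, add_sub_cancel_left, single_apply]
    split_ifs
    · exact hc
    · rw [v_zero hv]; exact hε0
  · intro x
    simp only [transvection, add_mulVec, one_mulVec, add_zero, single_mulVec]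
    ext k
    by_cases hk : k = i
    · subst hk; simp [E]
    · simp [E, hk]

lemma T_mem (hv : IsNAVal v) (q : Fin n → K) (hq : ∀ i, v (q i) ≤ 1) :
    MemSAe v 1 (⇑(Equiv.addRight q)) :=
  mk_mem hv le_rfl 1 q (by simp) (by simp [v_zero hv]) hq (by simp)

end SA
end S7

namespace S7
section Core
variable {K Γ : Type*} [Field K] [LinearOrderedCommGroupWithZero Γ] {w : Valuation K Γ} {t : K}

lemma shrink (ht : 1 < w t) {z : K} {r : Γ} (hr : 0 < r) (h : w (t * z) ≤ r) : w z < r := by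
  by_contra! hc
  have hz : 0 < w z := hr.trans_le hc
  rw [map_mul] at h
  have : 1 * w z < w t * w z := mul_lt_mul_of_pos_right ht hz
  rw [one_mul] at this
  exact absurd (hc.trans_lt this) (not_lt.2 h)

lemma cancel (ht : 1 < w t) {z : K} {r : Γ} (h : w (t * z) ≤ w t * r) : w z ≤ r := by
  rw [map_mul] at h
  exact le_of_mul_le_mul_left h (zero_lt_one.trans ht)

lemma w_nat (m : ℕ) : w (m : K) ≤ 1 := by
  induction m with
  | zero => simp
  | succ m ih => push_cast; exact w.map_add_le ih (by simp)

lemma w_nat_add (ht : 1 < w t) (m : ℕ) : w ((m : K) + t) = w t :=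
  Valuation.map_add_eq_of_lt_right w ((w_nat m).trans_lt ht)

lemma w_one_add (ht : 1 < w t) : w (1 + t) = w t := by simpa using w_nat_add ht 1
lemma w_two_add (ht : 1 < w t) : w (2 + t) = w t := by simpa using w_nat_add ht 2

/-- small relative to `ρ`, also after multiplication by `t` -/
def Sm (w : Valuation K Γ) (t : K) (ρ : Γ) (z : K) : Prop := w z < ρ ∧ w (t * z) < ρ

lemma sm_big1 (ht : 1 < w t) {r : Γ} (hr : 0 < r) {z : K} (h : w (t ^ 3 * z) ≤ r) :
    Sm w t r z := by
  have h1 : w (t ^ 2 * z) < r := shrink ht hr (by rwa [← mul_assoc, ← pow_succ'])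
  have h2 : w (t * z) < r := shrink ht hr (by rw [← mul_assoc, ← pow_two]; exact h1.le)
  exact ⟨shrink ht hr h2.le, h2⟩

lemma sm_one1 (ht : 1 < w t) {z : K} (h : w (t ^ 3 * z) ≤ w t) :
    Sm w t 1 z := by
  have h1 : w (t ^ 2 * z) ≤ 1 := cancel ht (by rwa [← mul_assoc, ← pow_succ', mul_one])
  have h2 : w (t * z) < 1 := shrink ht zero_lt_one (by rwa [← mul_assoc, ← pow_two])
  exact ⟨shrink ht zero_lt_one h2.le, h2⟩

lemma weaken (ht : 1 < w t) {r : Γ} (hr : 0 < r) {z : K} (h : w (t ^ 4 * z) ≤ r) :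
    w (t ^ 3 * z) ≤ r :=
  (shrink ht hr (by rwa [← mul_assoc, ← pow_succ'])).le

lemma cancel4 (ht : 1 < w t) {r : Γ} {z : K} (h : w (t ^ 4 * z) ≤ w t * r) :
    w (t ^ 3 * z) ≤ r :=
  cancel ht (by rwa [← mul_assoc, ← pow_succ'])

lemma sm_mul {ρ : Γ} {z c : K} (ht : w c = w t) (h : Sm w t ρ z) : w (c * z) < ρ := by
  rw [map_mul, ht, ← map_mul]; exact h.2

section
variable {ρ : Γ} {x y u1 u2 : K}

/-- case of large norm: two letters put both coordinates in the open ball -/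
lemma big (ht : 1 < w t) (hρ : w t < ρ) (h1 : u1 = x - 1 + t * (y - 1))
    (h2 : u2 = (y - 1) + (x - 1 + t * (y - 1))) (hxy : ¬ (w x < ρ ∧ w y < ρ)) :
    ¬ (Sm w t ρ x ∧ Sm w t ρ y) ∧ ¬ (Sm w t ρ u1 ∧ Sm w t ρ u2) ∧
    ¬ (Sm w t ρ x ∧ Sm w t ρ u1) ∧ ¬ (Sm w t ρ x ∧ Sm w t ρ u2) ∧
    ¬ (Sm w t ρ y ∧ Sm w t ρ u1) ∧ ¬ (Sm w t ρ y ∧ Sm w t ρ u2) := by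
  have e1 : w (1 + t) < ρ := by rwa [w_one_add ht]
  have e2 : w (2 + t) < ρ := by rwa [w_two_add ht]
  have e0 : w (1 : K) < ρ := by rw [map_one]; exact ht.trans hρ
  have hρ0 : 0 < ρ := zero_lt_one.trans (ht.trans hρ)
  refine ⟨fun ⟨a, b⟩ => hxy ⟨a.1, b.1⟩, fun ⟨a, b⟩ => hxy ⟨?_, ?_⟩, fun ⟨a, b⟩ => hxy ⟨a.1, ?_⟩,
    fun ⟨a, b⟩ => hxy ⟨a.1, ?_⟩, fun ⟨a, b⟩ => hxy ⟨?_, a.1⟩, fun ⟨a, b⟩ => hxy ⟨?_, a.1⟩⟩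
  · have : x = u1 - (t * u2 - t * u1) + 1 := by rw [h1, h2]; ring
    rw [this]
    exact w.map_add_lt (w.map_sub_lt a.1 (w.map_sub_lt b.2 a.2)) e0
  · have : y = u2 - u1 + 1 := by rw [h1, h2]; ring
    rw [this]
    exact w.map_add_lt (w.map_sub_lt b.1 a.1) e0
  · apply shrink ht hρ0
    have : t * y = u1 - x + (1 + t) := by rw [h1]; ring
    rw [this]
    exact (w.map_add_lt (w.map_sub_lt b.1 a.1) e1).le
  · apply shrink ht hρ0
    have : (1 + t) * y = u2 - x + (2 + t) := by rw [h2]; ring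
    rw [map_mul, ← w_one_add ht, ← map_mul, this]
    exact (w.map_add_lt (w.map_sub_lt b.1 a.1) e2).le
  · have : x = u1 - t * y + (1 + t) := by rw [h1]; ring
    rw [this]
    exact w.map_add_lt (w.map_sub_lt b.1 a.2) e1
  · have : x = u2 - (1 + t) * y + (2 + t) := by rw [h2]; ring
    rw [this]
    exact w.map_add_lt (w.map_sub_lt b.1 (sm_mul (w_one_add ht) a)) e2

lemma sml (ht : 1 < w t) (h1 : u1 = x - 1 + t * (y - 1))
    (h2 : u2 = (y - 1) + (x - 1 + t * (y - 1))) :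
    ¬ (Sm w t 1 x ∧ Sm w t 1 y ∧ Sm w t 1 u1) ∧ ¬ (Sm w t 1 x ∧ Sm w t 1 y ∧ Sm w t 1 u2) ∧
    ¬ (Sm w t 1 x ∧ Sm w t 1 u1 ∧ Sm w t 1 u2) ∧ ¬ (Sm w t 1 y ∧ Sm w t 1 u1 ∧ Sm w t 1 u2) := by
  refine ⟨fun ⟨a, b, c⟩ => ?_, fun ⟨a, b, c⟩ => ?_, fun ⟨a, b, c⟩ => ?_, fun ⟨a, b, c⟩ => ?_⟩
  · have : 1 + t = x + t * y - u1 := by rw [h1]; ring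
    have h : w (1 + t) < 1 := by rw [this]; exact w.map_sub_lt (w.map_add_lt a.1 b.2) c.1
    rw [w_one_add ht] at h
    exact lt_asymm h ht
  · have : 2 + t = x + (1 + t) * y - u2 := by rw [h2]; ring
    have h : w (2 + t) < 1 := by
      rw [this]; exact w.map_sub_lt (w.map_add_lt a.1 (sm_mul (w_one_add ht) b)) c.1
    rw [w_two_add ht] at h
    exact lt_asymm h ht
  · have : (1 : K) = x - (u1 - (t * u2 - t * u1)) := by rw [h1, h2]; ring
    have h : w (1 : K) < 1 := by
      rw [this]; exact w.map_sub_lt a.1 (w.map_sub_lt b.1 (w.map_sub_lt c.2 b.2))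
    simp at h
  · have : (1 : K) = y - (u2 - u1) := by rw [h1, h2]; ring
    have h : w (1 : K) < 1 := by
      rw [this]; exact w.map_sub_lt a.1 (w.map_sub_lt c.1 b.1)
    simp at h
end
end Core
end S7

namespace S7
section Fin
variable {K Γ : Type*} [Field K] [LinearOrderedCommGroupWithZero Γ] {n : ℕ}

/-- first generator -/
def ga (i j : Fin n) (h : i ≠ j) (t : K) : Equiv.Perm (Fin n → K) :=
  E i j h (t ^ 4) * E j i h.symm (t ^ 4)

/-- the conjugator -/
def gc (i j : Fin n) (h : i ≠ j) (t : K) : Equiv.Perm (Fin n → K) :=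
  Equiv.addRight (fun _ => 1) * E i j h (-t) * E j i h.symm (-1)

/-- second generator -/
def gb (i j : Fin n) (h : i ≠ j) (t : K) : Equiv.Perm (Fin n → K) :=
  gc i j h t * ga i j h t * (gc i j h t)⁻¹

/-- the height -/
def Nm (w : Valuation K Γ) (i j : Fin n) (t : K) (x : Fin n → K) : Γ :=
  max (w t) (max (w (x i)) (w (x j)))

lemma ga_j (i j : Fin n) (h : i ≠ j) (t : K) (x : Fin n → K) :
    ga i j h t x j = x j + t ^ 4 * x i := by
  simp [ga, E_same, E_other]

lemma ga_inv_i (i j : Fin n) (h : i ≠ j) (t : K) (x : Fin n → K) :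
    (ga i j h t)⁻¹ x i = x i - t ^ 4 * x j := by
  simp only [ga, mul_inv_rev, E_inv, Equiv.Perm.mul_apply, E_same, E_other]; ring

lemma gc_inv (i j : Fin n) (h : i ≠ j) (t : K) (x : Fin n → K) :
    (gc i j h t)⁻¹ x i = x i - 1 + t * (x j - 1) ∧
    (gc i j h t)⁻¹ x j = (x j - 1) + (x i - 1 + t * (x j - 1)) := by
  have h1 : ∀ k, (Equiv.addRight (fun _ => (1 : K)))⁻¹ x k = x k - 1 := fun k => by
    rw [show (Equiv.addRight (fun _ => (1 : K)))⁻¹ x = x - fun _ => 1 by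
      rw [Equiv.Perm.inv_eq_iff_eq]; simp]
    simp
  constructor <;>
  simp only [gc, mul_inv_rev, E_inv, Equiv.Perm.mul_apply, E_same, E_other, h1] <;> ring

variable {w : Valuation K Γ} {t : K} {i j : Fin n}

lemma le_i (w : Valuation K Γ) (t : K) (i j : Fin n) (x : Fin n → K) : w (x i) ≤ Nm w i j t x :=
  (le_max_left _ _).trans (le_max_right _ _)

lemma le_j (w : Valuation K Γ) (t : K) (i j : Fin n) (x : Fin n → K) : w (x j) ≤ Nm w i j t x :=
  (le_max_right _ _).trans (le_max_right _ _)

lemma le_t (w : Valuation K Γ) (t : K) (i j : Fin n) (x : Fin n → K) : w t ≤ Nm w i j t x :=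
  le_max_left _ _

lemma q_a (h : i ≠ j) {y : Fin n → K} {r : Γ} (h1 : w (y j) ≤ r) (h2 : w (ga i j h t y j) ≤ r) :
    w (t ^ 4 * y i) ≤ r := by
  rw [ga_j] at h2
  have := w.map_sub_le h2 h1
  rwa [add_sub_cancel_left] at this

lemma q_a' (h : i ≠ j) {y : Fin n → K} {r : Γ} (h1 : w (y i) ≤ r)
    (h2 : w ((ga i j h t)⁻¹ y i) ≤ r) : w (t ^ 4 * y j) ≤ r := by
  rw [ga_inv_i] at h2
  have := w.map_sub_le h1 h2
  rwa [sub_sub_cancel] at this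

lemma c_bound (h : i ≠ j) (ht : 1 < w t) {y : Fin n → K} {r : Γ} (hr : w t ≤ r)
    (hi : w (y i) ≤ r) (hj : w (y j) ≤ r) :
    w ((gc i j h t)⁻¹ y i) ≤ w t * r ∧ w ((gc i j h t)⁻¹ y j) ≤ w t * r := by
  have h1 : w (1 : K) ≤ r := by rw [map_one]; exact ht.le.trans hr
  have hrr : r ≤ w t * r := le_mul_of_one_le_left' ht.le
  have hi1 := (w.map_sub_le hi h1)
  have hj1 := (w.map_sub_le hj h1)
  have htj : w (t * (y j - 1)) ≤ w t * r := by
    rw [map_mul]; exact mul_le_mul_right hj1 _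
  rw [(gc_inv i j h t y).1, (gc_inv i j h t y).2]
  have := w.map_add_le (hi1.trans hrr) htj
  exact ⟨this, w.map_add_le (hj1.trans hrr) this⟩

lemma logic2 (Q : Bool × Bool → Prop) (x y u1 u2 : Prop) (a1 : Q (true, false) → x)
    (a2 : Q (true, true) → y) (b1 : Q (false, false) → u1) (b2 : Q (false, true) → u2)
    (h : ¬ (x ∧ y) ∧ ¬ (u1 ∧ u2) ∧ ¬ (x ∧ u1) ∧ ¬ (x ∧ u2) ∧ ¬ (y ∧ u1) ∧ ¬ (y ∧ u2))
    (s r : Bool × Bool) (hsr : s ≠ r) (hs : Q s) (hr : Q r) : False := by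
  rcases s with ⟨_ | _, _ | _⟩ <;> rcases r with ⟨_ | _, _ | _⟩ <;> first
    | exact hsr rfl
    | (clear hsr; tauto)

lemma logic3 (Q : Bool × Bool → Prop) (x y u1 u2 : Prop) (a1 : Q (true, false) → x)
    (a2 : Q (true, true) → y) (b1 : Q (false, false) → u1) (b2 : Q (false, true) → u2)
    (h : ¬ (x ∧ y ∧ u1) ∧ ¬ (x ∧ y ∧ u2) ∧ ¬ (x ∧ u1 ∧ u2) ∧ ¬ (y ∧ u1 ∧ u2))
    (s r q : Bool × Bool) (hsr : s ≠ r) (hsq : s ≠ q) (hrq : r ≠ q) (hs : Q s) (hr : Q r)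
    (hq : Q q) : False := by
  obtain ⟨h1, h2, h3, h4⟩ := h
  rcases s with ⟨_ | _, _ | _⟩ <;> rcases r with ⟨_ | _, _ | _⟩ <;> first
    | exact hsr rfl
    | (rcases q with ⟨_ | _, _ | _⟩ <;> first
        | exact hsq rfl
        | exact hrq rfl
        | exact h1 ⟨a1 ‹_›, a2 ‹_›, b1 ‹_›⟩
        | exact h2 ⟨a1 ‹_›, a2 ‹_›, b2 ‹_›⟩
        | exact h3 ⟨a1 ‹_›, b1 ‹_›, b2 ‹_›⟩
        | exact h4 ⟨a2 ‹_›, b1 ‹_›, b2 ‹_›⟩)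

lemma good (h : i ≠ j) (ht : 1 < w t) :
    Good (fun s : Bool => if s then ga i j h t else gb i j h t) (Nm w i j t) := by
  set N := Nm w i j t with hN
  set f := (fun s : Bool => if s then ga i j h t else gb i j h t) with hf
  have lt1 : ltr f (true, true) = (ga i j h t)⁻¹ := rfl
  have lt2 : ltr f (true, false) = ga i j h t := by simp [ltr, hf]
  have lt3 : ltr f (false, true) = (gb i j h t)⁻¹ := rfl
  have lt4 : ltr f (false, false) = gb i j h t := by simp [ltr, hf]
  have A1 : ∀ y, N (ltr f (true, false) y) ≤ N y → w (t ^ 4 * y i) ≤ N y := by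
    intro y hy
    rw [lt2] at hy
    exact q_a h (le_j w t i j y) ((le_j w t i j _).trans hy)
  have A2 : ∀ y, N (ltr f (true, true) y) ≤ N y → w (t ^ 4 * y j) ≤ N y := by
    intro y hy
    rw [lt1] at hy
    exact q_a' h (le_i w t i j y) ((le_i w t i j _).trans hy)
  have B1 : ∀ y, N (ltr f (false, false) y) ≤ N y →
      w (t ^ 4 * (gc i j h t)⁻¹ y i) ≤ w t * N y := by
    intro y hy
    rw [lt4] at hy
    refine q_a h (c_bound h ht (le_t w t i j y) (le_i w t i j y) (le_j w t i j y)).2 ?_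
    have := (c_bound h ht (y := gb i j h t y) (le_t w t i j y) ((le_i w t i j _).trans hy)
      ((le_j w t i j _).trans hy)).2
    simpa [gb] using this
  have B2 : ∀ y, N (ltr f (false, true) y) ≤ N y →
      w (t ^ 4 * (gc i j h t)⁻¹ y j) ≤ w t * N y := by
    intro y hy
    rw [lt3] at hy
    refine q_a' h (c_bound h ht (le_t w t i j y) (le_i w t i j y) (le_j w t i j y)).1 ?_
    have := (c_bound h ht (y := (gb i j h t)⁻¹ y) (le_t w t i j y) ((le_i w t i j _).trans hy)
      ((le_j w t i j _).trans hy)).1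
    simpa [gb, mul_assoc] using this
  have t0 : 0 < w t := zero_lt_one.trans ht
  have pos : ∀ y, 0 < N y := fun y => t0.trans_le (le_t w t i j y)
  have two : ∀ y, w t < N y → ∀ s r : Bool × Bool, s ≠ r → N (ltr f s y) ≤ N y →
      N y < N (ltr f r y) := by
    intro y hy
    have hb := big (x := y i) (y := y j) ht hy (gc_inv i j h t y).1 (gc_inv i j h t y).2 (by
      rintro ⟨h1, h2⟩
      have : N y < N y := by
        conv_lhs => rw [hN, Nm]
        exact max_lt hy (max_lt h1 h2)
      exact lt_irrefl _ this)
    have a1 := fun k => sm_big1 ht (pos y) (weaken ht (pos y) (A1 y k))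
    have a2 := fun k => sm_big1 ht (pos y) (weaken ht (pos y) (A2 y k))
    have b1 := fun k => sm_big1 ht (pos y) (cancel4 ht (B1 y k))
    have b2 := fun k => sm_big1 ht (pos y) (cancel4 ht (B2 y k))
    intro s r hsr hs
    by_contra! hr
    exact logic2 (fun s => N (ltr f s y) ≤ N y) _ _ _ _ a1 a2 b1 b2 hb s r hsr hs hr
  refine ⟨?_, ?_⟩
  · intro s r hsr y hy
    exact two y ((le_t w t i j _).trans_lt hy) s r hsr hy.le
  · intro s r q hsr hsq hrq y hs hr
    rcases (le_t w t i j y).lt_or_eq with hy | hy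
    · exact two y hy s q hsq hs
    · have hb := sml (x := y i) (y := y j) ht (gc_inv i j h t y).1 (gc_inv i j h t y).2
      have hy' : N y = w t := hy.symm
      have a1 := fun k => sm_one1 ht (hy' ▸ weaken ht (pos y) (A1 y k))
      have a2 := fun k => sm_one1 ht (hy' ▸ weaken ht (pos y) (A2 y k))
      have b1 := fun k => sm_one1 ht (hy' ▸ cancel4 ht (B1 y k))
      have b2 := fun k => sm_one1 ht (hy' ▸ cancel4 ht (B2 y k))
      by_contra! hq
      exact logic3 (fun s => N (ltr f s y) ≤ N y) _ _ _ _ a1 a2 b1 b2 hb s r q hsr hsq hrq hs hr hq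

lemma pts (h : i ≠ j) (ht : 1 < w t) (s : Bool × Bool) : ∃ x, Nm w i j t x <
    Nm w i j t (ltr (fun s : Bool => if s then ga i j h t else gb i j h t) s x) := by
  have H := good h ht
  have fa : ga i j h t 0 = 0 := by
    ext k; simp [ga, E]
  have fb : gb i j h t (gc i j h t 0) = gc i j h t 0 := by simp [gb, fa]
  set f := (fun s : Bool => if s then ga i j h t else gb i j h t) with hf
  have fix : ∀ s b x, f s x = x → ltr f (s, b) x = x := by
    intro s b x hx
    cases b
    · simpa [ltr] using hx
    · simp only [ltr, cond_true]; rw [Equiv.Perm.inv_eq_iff_eq]; exact hx.symm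
  rcases s with ⟨s, b⟩
  obtain ⟨x, hx⟩ : ∃ x, f (!s) x = x := by
    cases s
    · exact ⟨0, fa⟩
    · exact ⟨_, fb⟩
  exact ⟨x, H.c2 (!s, false) (!s, true) (s, b) (by simp) (by simp) (by simp) x
    (by rw [fix _ _ _ hx]) (by rw [fix _ _ _ hx])⟩

end Fin
end S7

theorem statement7 {K : Type*} [Field K] (v : K → ℝ) (hv : IsNAVal v)
    -- the valuation is nontrivial
    (hnt : ∃ x : K, x ≠ 0 ∧ v x ≠ 1)
    -- ch K = ch k: the valuation is trivial on the prime subfield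
    (hchar : ∀ m : ℕ, (m : K) ≠ 0 → v ((m : K)) = 1)
    (n : ℕ) (hn : 2 ≤ n) (ε : ℝ) (hε0 : 0 < ε) (hε1 : ε ≤ 1) :
    ∃ a b : Equiv.Perm (Fin n → K),
      -- the free subgroup F₂ generated by {a, b} is contained in SA(n, D_K, ε) …
      (∀ g ∈ Subgroup.closure {a, b}, MemSAe v ε ⇑g) ∧
      -- … {a, b} is a free basis of F₂ …
      Function.Injective ⇑(FreeGroup.lift fun t : Bool => if t then a else b) ∧
      -- … and the action of F₂ on K^n is locally commutative
      (∀ g ∈ Subgroup.closure {a, b}, ∀ h ∈ Subgroup.closure {a, b},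
        ∀ x : Fin n → K, g x = x → h x = x → g * h = h * g) := by
  obtain ⟨t₀, h00, h01⟩ : ∃ t : K, t ≠ 0 ∧ v t < 1 := by
    obtain ⟨x, hx0, hx1⟩ := hnt
    rcases lt_or_gt_of_ne hx1 with h | h
    · exact ⟨x, hx0, h⟩
    · refine ⟨x⁻¹, inv_ne_zero hx0, ?_⟩
      have := hv.2.2.1 x x⁻¹
      rw [mul_inv_cancel₀ hx0, S7.v_one hv] at this
      by_contra! hc
      nlinarith
  have vpow : ∀ (x : K) (m : ℕ), v (x ^ m) = v x ^ m := by
    intro x m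
    induction m with
    | zero => simp [S7.v_one hv]
    | succ m ih => rw [pow_succ, hv.2.2.1, ih, pow_succ]
  obtain ⟨t, ht0, ht1, htε⟩ : ∃ t : K, t ≠ 0 ∧ v t < 1 ∧ v t ≤ ε := by
    obtain ⟨m, hm⟩ := exists_pow_lt_of_lt_one hε0 h01
    have h2 : v (t₀ ^ (m + 1)) < ε := by
      rw [vpow, pow_succ]
      have := hv.1 t₀
      have : 0 ≤ v t₀ ^ m := by positivity
      nlinarith
    exact ⟨t₀ ^ (m + 1), pow_ne_zero _ h00, h2.trans_le hε1, h2.le⟩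
  obtain ⟨V, hV⟩ := S7.exists_val hv hchar t ht0 ht1
  have ht : 1 < V.valuation t := by
    rw [← not_le, ValuationSubring.valuation_le_one_iff]; exact hV
  have htP : v (t ^ 4) ≤ ε := by
    rw [vpow]
    have h0 := hv.1 t
    have : v t ^ 4 ≤ v t := by
      simpa using pow_le_pow_of_le_one h0 ht1.le (show 1 ≤ 4 by norm_num)
    exact this.trans htε
  have hij : (⟨0, by omega⟩ : Fin n) ≠ ⟨1, by omega⟩ := by simp
  generalize (⟨0, by omega⟩ : Fin n) = i at hij
  generalize (⟨1, by omega⟩ : Fin n) = j at hij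
  have H := S7.good (w := V.valuation) (t := t) hij ht
  have e0 := hε0.le
  have ha : MemSAe v ε (⇑(S7.ga i j hij t)) :=
    S7.mem_mul hv e0 hε1 (S7.E_mem hv e0 hε1 _ _ _ _ htP) (S7.E_mem hv e0 hε1 _ _ _ _ htP)
  have ha' : MemSAe v ε (⇑(S7.ga i j hij t)⁻¹) := by
    rw [S7.ga, mul_inv_rev, S7.E_inv, S7.E_inv]
    exact S7.mem_mul hv e0 hε1 (S7.E_mem hv e0 hε1 _ _ _ _ (by rwa [S7.v_neg hv]))
      (S7.E_mem hv e0 hε1 _ _ _ _ (by rwa [S7.v_neg hv]))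
  have z1 := zero_le_one (α := ℝ)
  have v1 := S7.v_one hv
  have hc : MemSAe v 1 (⇑(S7.gc i j hij t)) :=
    S7.mem_mul hv z1 le_rfl (S7.mem_mul hv z1 le_rfl (S7.T_mem hv _ fun _ => v1.le)
      (S7.E_mem hv z1 le_rfl _ _ _ _ (by rw [S7.v_neg hv]; exact ht1.le)))
      (S7.E_mem hv z1 le_rfl _ _ _ _ (by rw [S7.v_neg hv]; exact v1.le))
  have hc' : MemSAe v 1 (⇑(S7.gc i j hij t)⁻¹) := by
    have hT : (Equiv.addRight (fun _ : Fin n => (1 : K)))⁻¹ = Equiv.addRight (fun _ => -1) := by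
      ext x k
      rw [show (Equiv.addRight (fun _ => (1 : K)))⁻¹ x = x + fun _ => -1 by
        rw [Equiv.Perm.inv_eq_iff_eq]; ext k; simp]
      simp
    rw [S7.gc, mul_inv_rev, mul_inv_rev, S7.E_inv, S7.E_inv, hT]
    exact S7.mem_mul hv z1 le_rfl (S7.E_mem hv z1 le_rfl _ _ _ _ (by rw [neg_neg]; exact v1.le))
      (S7.mem_mul hv z1 le_rfl (S7.E_mem hv z1 le_rfl _ _ _ _ (by rw [neg_neg]; exact ht1.le))
      (S7.T_mem hv _ fun _ => by rw [S7.v_neg hv]; exact v1.le))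
  have hb : MemSAe v ε (⇑(S7.gb i j hij t)) := S7.mem_conj hv e0 hε1 hc hc' ha
  have hb' : MemSAe v ε (⇑(S7.gb i j hij t)⁻¹) := by
    have : (S7.gb i j hij t)⁻¹ = S7.gc i j hij t * (S7.ga i j hij t)⁻¹ * (S7.gc i j hij t)⁻¹ := by
      rw [S7.gb]; group
    rw [this]
    exact S7.mem_conj hv e0 hε1 hc hc' ha'
  refine ⟨S7.ga i j hij t, S7.gb i j hij t, ?_, S7.inj_aux H (S7.pts hij ht), ?_⟩
  · intro g hg
    induction hg using Subgroup.closure_induction'' with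
    | mem x hx =>
      rcases hx with rfl | rfl
      · exact ha
      · exact hb
    | inv_mem x hx =>
      rcases hx with rfl | rfl
      · exact ha'
      · exact hb'
    | one => exact S7.mem_one hv e0 hε1
    | mul x y _ _ hx hy => exact S7.mem_mul hv e0 hε1 hx hy
  · have hrange : ∀ g ∈ Subgroup.closure {S7.ga i j hij t, S7.gb i j hij t}, ∃ u,
        FreeGroup.lift (fun s : Bool => if s then S7.ga i j hij t else S7.gb i j hij t) u = g := by
      intro g hg
      rw [← MonoidHom.mem_range, FreeGroup.range_lift_eq_closure]
      refine Subgroup.closure_mono ?_ hg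
      rintro x (rfl | rfl)
      · exact ⟨true, rfl⟩
      · exact ⟨false, rfl⟩
    intro g hg h hh x hgx hhx
    obtain ⟨u, rfl⟩ := hrange g hg
    obtain ⟨u', rfl⟩ := hrange h hh
    rw [← map_mul, ← map_mul, (S7.comm_aux H _ u u' x (Nat.lt_succ_self _) hgx hhx).eq]
end
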